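/- (Smooth dependence in Morse area normal form, 1D.) Let p(x,ξ) be a smooth real-valued function on an open subset of ℝ², A ∈ ℝ, such that K_A = {p ≤ A} is compact, p has exactly one critical point (x₀,ξ₀) in K_A with p(x₀,ξ₀) < A, and the Hessian of p at (x₀,ξ₀) is positive definite. Then there exists a smooth function F on [p(x₀,ξ₀), A] with F′ > 0, F(p(x₀,ξ₀)) = 0, and an area-preserving orientation-preserving diffeomorphism Ψ from K_A onto the closed disc {(x,ξ) : (x²+ξ²)/2 ≤ F(A)} such that F(p(x,ξ)) = (Ψ₁(x,ξ)² + Ψ₂(x,ξ)²)/2 on K_A. Moreover F′(p(x₀,ξ₀)) = (det ∇²p(x₀,ξ₀))^{−1/2}. -/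

import Mathlib

open Set



/-! ### Part 1: smooth parametric integrals -/
namespace MorseArea
open scoped ContDiff Topology
open MeasureTheory Filter

theorem hasFDerivAt_paramInt {E F : Type} [NormedAddCommGroup E] [NormedSpace ℝ E]
    [FiniteDimensional ℝ E] [NormedAddCommGroup F] [NormedSpace ℝ F]
    (f : E × ℝ → F) (hf : ContDiff ℝ 1 f) (a b : ℝ) (x : E) :
    HasFDerivAt (fun x => ∫ t in a..b, f (x, t))
      (∫ t in a..b, (fderiv ℝ f (x, t)).comp (ContinuousLinearMap.inl ℝ E ℝ)) x := by
  have hcf : Continuous f := hf.continuous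
  have hcd : Continuous (fun q : E × ℝ =>
      (fderiv ℝ f q).comp (ContinuousLinearMap.inl ℝ E ℝ)) := by
    have := hf.continuous_fderiv (by simp)
    fun_prop
  have hK : IsCompact (Metric.closedBall x 1 ×ˢ uIcc a b) :=
    (ProperSpace.isCompact_closedBall x 1).prod isCompact_uIcc
  obtain ⟨C, hC⟩ := hK.exists_bound_of_continuousOn hcd.continuousOn
  refine intervalIntegral.hasFDerivAt_integral_of_dominated_of_fderiv_le
    (s := Metric.closedBall x 1) (bound := fun _ => C)
    (F := fun x t => f (x, t))
    (F' := fun x t => (fderiv ℝ f (x, t)).comp (ContinuousLinearMap.inl ℝ E ℝ))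
    (Metric.closedBall_mem_nhds x one_pos) ?_ ?_ ?_ ?_ ?_ ?_
  · exact Eventually.of_forall fun y =>
      (hcf.comp (by fun_prop : Continuous fun t : ℝ => (y, t))).aestronglyMeasurable
  · exact (hcf.comp (by fun_prop : Continuous fun t : ℝ => (x, t))).intervalIntegrable _ _
  · exact (hcd.comp (by fun_prop : Continuous fun t : ℝ => (x, t))).aestronglyMeasurable
  · exact Eventually.of_forall fun t ht y hy => hC (y, t) ⟨hy, uIoc_subset_uIcc ht⟩
  · exact intervalIntegrable_const
  · refine Eventually.of_forall fun t ht y hy => ?_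
    have h1 : HasFDerivAt f (fderiv ℝ f (y, t)) (y, t) :=
      (hf.differentiable (by simp) (y, t)).hasFDerivAt
    exact h1.comp y (hasFDerivAt_prodMk_left y t)

theorem contDiff_paramInt_nat {E : Type} [NormedAddCommGroup E] [NormedSpace ℝ E]
    [FiniteDimensional ℝ E] (a b : ℝ) (n : ℕ) :
    ∀ {F : Type} [NormedAddCommGroup F] [NormedSpace ℝ F] 
    (f : E × ℝ → F) (_ : ContDiff ℝ ∞ f),
    ContDiff ℝ n (fun x => ∫ t in a..b, f (x, t)) := by
  induction n with
  | zero =>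
    intro F _ _ f hf
    have h : ∀ x, HasFDerivAt _ _ x := hasFDerivAt_paramInt f (hf.of_le (by simp)) a b
    simp only [Nat.cast_zero, contDiff_zero]
    exact continuous_iff_continuousAt.2 fun x => (h x).continuousAt
  | succ n ih =>
    intro F _ _ f hf
    push_cast
    rw [contDiff_succ_iff_hasFDerivAt]
    refine ⟨_, ?_, hasFDerivAt_paramInt f (hf.of_le (by simp)) a b⟩
    refine ih (fun q : E × ℝ => (fderiv ℝ f q).comp (ContinuousLinearMap.inl ℝ E ℝ)) ?_
    exact (hf.fderiv_right (m := ∞) (by simp)).clm_comp contDiff_const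

theorem contDiff_paramInt {E : Type} [NormedAddCommGroup E] [NormedSpace ℝ E]
    [FiniteDimensional ℝ E] {F : Type} [NormedAddCommGroup F] [NormedSpace ℝ F]
    (f : E × ℝ → F) (hf : ContDiff ℝ ∞ f) (a b : ℝ) :
    ContDiff ℝ ∞ (fun x => ∫ t in a..b, f (x, t)) :=
  contDiff_infty.2 fun n => contDiff_paramInt_nat a b n f hf

/-- Hadamard's lemma in dimension 2. -/
theorem hadamard2 (f : ℝ × ℝ → ℝ) (hf : ContDiff ℝ ∞ f) :
    ∃ f₁ f₂ : ℝ × ℝ → ℝ, ContDiff ℝ ∞ f₁ ∧ ContDiff ℝ ∞ f₂ ∧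
      (∀ v, f v = f 0 + v.1 * f₁ v + v.2 * f₂ v) ∧
      f₁ 0 = fderiv ℝ f 0 (1, 0) ∧ f₂ 0 = fderiv ℝ f 0 (0, 1) := by
  have hd : ContDiff ℝ ∞ (fderiv ℝ f) := hf.fderiv_right (by simp)
  have hs : ContDiff ℝ ∞ (fun q : (ℝ × ℝ) × ℝ => fderiv ℝ f (q.2 • q.1)) :=
    hd.comp (contDiff_snd.smul contDiff_fst)
  refine ⟨fun v => ∫ t in (0:ℝ)..1, fderiv ℝ f (t • v) (1, 0),
    fun v => ∫ t in (0:ℝ)..1, fderiv ℝ f (t • v) (0, 1),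
    contDiff_paramInt (fun q : (ℝ × ℝ) × ℝ => fderiv ℝ f (q.2 • q.1) (1, 0))
      (hs.clm_apply contDiff_const) 0 1,
    contDiff_paramInt (fun q : (ℝ × ℝ) × ℝ => fderiv ℝ f (q.2 • q.1) (0, 1))
      (hs.clm_apply contDiff_const) 0 1, ?_, by simp, by simp⟩
  intro v
  have hdv : ∀ w, Continuous fun t : ℝ => fderiv ℝ f (t • v) w := fun w => by
    have := hd.continuous
    fun_prop
  have h1 : ∀ t ∈ uIcc (0:ℝ) 1,
      HasDerivAt (fun t : ℝ => f (t • v)) (fderiv ℝ f (t • v) v) t := by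
    intro t _
    have h := (hf.differentiable (by simp) (t • v)).hasFDerivAt
    have h2 : HasDerivAt (fun t : ℝ => t • v) v t := by
      simpa using (hasDerivAt_id t).smul_const v
    exact h.comp_hasDerivAt t h2
  have h2 := intervalIntegral.integral_eq_sub_of_hasDerivAt h1
    ((hdv v).intervalIntegrable _ _)
  have h3 : ∀ t : ℝ, fderiv ℝ f (t • v) v
      = v.1 * fderiv ℝ f (t • v) (1, 0) + v.2 * fderiv ℝ f (t • v) (0, 1) := by
    intro t
    have : v = v.1 • ((1:ℝ), (0:ℝ)) + v.2 • ((0:ℝ), (1:ℝ)) := by ext <;> simp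
    conv_lhs => rw [this]
    rw [map_add, map_smul, map_smul]
    simp [← this]
  simp only [h3] at h2
  rw [intervalIntegral.integral_add ((hdv _).const_mul _ |>.intervalIntegrable _ _)
    ((hdv _).const_mul _ |>.intervalIntegrable _ _),
    intervalIntegral.integral_const_mul, intervalIntegral.integral_const_mul] at h2
  simp only [one_smul, zero_smul] at h2
  linarith

end MorseArea


/-! ### Part 2: a smooth time-one flow map -/
namespace MorseArea
open scoped ContDiff Topology unitInterval NNReal
open MeasureTheory Filter

/-- Composition operator on continuous curves. -/
noncomputable def nem {E F : Type} [NormedAddCommGroup E] [NormedAddCommGroup F] 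
    (V : E → F) (hV : Continuous V) (γ : C(I, E)) : C(I, F) := ⟨fun t => V (γ t), by fun_prop⟩

/-- Pointwise application as a bounded bilinear map. -/
noncomputable def appl (E F : Type) [NormedAddCommGroup E] [NormedSpace ℝ E]
    [NormedAddCommGroup F] [NormedSpace ℝ F] :
    C(I, E →L[ℝ] F) →L[ℝ] C(I, E) →L[ℝ] C(I, F) :=
  LinearMap.mkContinuous₂
    (LinearMap.mk₂ ℝ (fun (L : C(I, E →L[ℝ] F)) (η : C(I, E)) =>
      (⟨fun t => L t (η t), by fun_prop⟩ : C(I, F)))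
      (by intros; ext; simp) (by intros; ext; simp) (by intros; ext; simp)
      (by intros; ext; simp)) 1 (by
    intro L η
    rw [one_mul, ContinuousMap.norm_le _ (by positivity)]
    intro t
    exact (L t).le_of_opNorm_le_of_le (L.norm_coe_le_norm t) (η.norm_coe_le_norm t))

theorem appl_apply {E F : Type} [NormedAddCommGroup E] [NormedSpace ℝ E]
    [NormedAddCommGroup F] [NormedSpace ℝ F] (L : C(I, E →L[ℝ] F)) (η : C(I, E)) (t : I) :
    appl E F L η t = L t (η t) := rfl

theorem hasFDerivAt_nem {E F : Type} [NormedAddCommGroup E] [NormedSpace ℝ E]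
    [FiniteDimensional ℝ E]
    [NormedAddCommGroup F] [NormedSpace ℝ F] (V : E → F) (hV : ContDiff ℝ 1 V)
    (γ : C(I, E)) :
    HasFDerivAt (nem V hV.continuous)
      (appl E F (nem (fderiv ℝ V) (hV.continuous_fderiv (by simp)) γ)) γ := by
  have hcd : Continuous (fderiv ℝ V) := hV.continuous_fderiv (by simp)
  rw [hasFDerivAt_iff_isLittleO_nhds_zero, Asymptotics.isLittleO_iff]
  intro ε hε
  -- uniform continuity on a ball
  have hK : IsCompact (Metric.closedBall (0:E) (‖γ‖ + 1)) := ProperSpace.isCompact_closedBall _ _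
  have huc := hK.uniformContinuousOn_of_continuous hcd.continuousOn
  rw [Metric.uniformContinuousOn_iff] at huc
  obtain ⟨δ, hδ, hh⟩ := huc ε hε
  have : ∀ᶠ η : C(I, E) in 𝓝 0, ‖η‖ < min δ 1 := by
    have := Metric.ball_mem_nhds (0 : C(I, E)) (lt_min hδ one_pos)
    filter_upwards [this] with η hη
    simpa using hη
  filter_upwards [this] with η hη
  rw [ContinuousMap.norm_le _ (by positivity)]
  intro t
  have hηt : ‖η t‖ < min δ 1 := (η.norm_coe_le_norm t).trans_lt hη
  have hγt := γ.norm_coe_le_norm t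
  have hseg : ∀ y ∈ segment ℝ (γ t) (γ t + η t), ‖fderiv ℝ V y - fderiv ℝ V (γ t)‖ ≤ ε := by
    intro y hy
    have hd : ‖y - γ t‖ ≤ ‖η t‖ := by
      rw [segment_eq_image'] at hy
      obtain ⟨θ, ⟨h0, h1⟩, rfl⟩ := hy
      simp only [add_sub_cancel_left, norm_smul, Real.norm_eq_abs, abs_of_nonneg h0]
      nlinarith [norm_nonneg (η t)]
    have hyn : ‖y‖ ≤ ‖γ‖ + 1 := by
      have : ‖y‖ ≤ ‖γ t‖ + ‖y - γ t‖ := by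
        simpa using norm_add_le (γ t) (y - γ t)
      have := min_le_right δ 1
      linarith
    have := hh y (by simpa using hyn) (γ t) (by simp; linarith)
      (by rw [dist_eq_norm]; exact (hd.trans_lt hηt).trans_le (min_le_left _ _))
    rw [dist_eq_norm] at this
    exact this.le
  have hmv := Convex.norm_image_sub_le_of_norm_hasFDerivWithin_le'
    (f := V) (f' := fderiv ℝ V) (φ := fderiv ℝ V (γ t)) (s := segment ℝ (γ t) (γ t + η t))
    (C := ε) (x := γ t) (y := γ t + η t)
    (fun y _ => (hV.differentiable (by simp) y).hasFDerivAt.hasFDerivWithinAt) hseg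
    (convex_segment _ _) (left_mem_segment _ _ _) (right_mem_segment _ _ _)
  simp only [add_sub_cancel_left] at hmv
  calc _ = ‖V (γ t + η t) - V (γ t) - fderiv ℝ V (γ t) (η t)‖ := rfl
    _ ≤ ε * ‖η t‖ := hmv
    _ ≤ ε * ‖η‖ := by gcongr; exact η.norm_coe_le_norm t

theorem contDiff_nem_nat {E : Type} [NormedAddCommGroup E] [NormedSpace ℝ E]
    [FiniteDimensional ℝ E] (n : ℕ) :
    ∀ {F : Type} [NormedAddCommGroup F] [NormedSpace ℝ F] (V : E → F) (hV : ContDiff ℝ ∞ V),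
    ContDiff ℝ n (nem V hV.continuous) := by
  induction n with
  | zero =>
    intro F _ _ V hV
    have h := hasFDerivAt_nem V (hV.of_le (by simp))
    simp only [Nat.cast_zero, contDiff_zero]
    exact continuous_iff_continuousAt.2 fun x => (h x).continuousAt
  | succ n ih =>
    intro F _ _ V hV
    push_cast
    rw [contDiff_succ_iff_hasFDerivAt]
    refine ⟨_, ?_, hasFDerivAt_nem V (hV.of_le (by simp))⟩
    exact (ContinuousLinearMap.contDiff (F := C(I, E) →L[ℝ] C(I, F)) (appl E F)).comp (ih (fderiv ℝ V) (hV.fderiv_right (by simp)))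

theorem contDiff_nem {E : Type} [NormedAddCommGroup E] [NormedSpace ℝ E]
    [FiniteDimensional ℝ E] 
    {F : Type} [NormedAddCommGroup F] [NormedSpace ℝ F] (V : E → F) (hV : ContDiff ℝ ∞ V) :
    ContDiff ℝ ∞ (nem V hV.continuous) :=
  contDiff_infty.2 fun n => contDiff_nem_nat n V hV

/-- The integration operator on curves. -/
noncomputable def integ (E : Type) [NormedAddCommGroup E] [NormedSpace ℝ E] [CompleteSpace E] :
    C(I, E) →L[ℝ] C(I, E) :=
  LinearMap.mkContinuous
    { toFun := fun γ => ⟨fun t : I => ∫ s in (0:ℝ)..t, IccExtend zero_le_one γ s, by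
        have h : Continuous fun t : ℝ => ∫ s in (0:ℝ)..t, IccExtend zero_le_one γ s :=
          intervalIntegral.continuous_primitive
            (fun a b => (γ.continuous.Icc_extend' (h := zero_le_one)).intervalIntegrable a b) 0
        exact h.comp continuous_subtype_val⟩
      map_add' := fun γ η => by
        ext t
        exact intervalIntegral.integral_add
          ((γ.continuous.Icc_extend' (h := zero_le_one)).intervalIntegrable _ _)
          ((η.continuous.Icc_extend' (h := zero_le_one)).intervalIntegrable _ _)
      map_smul' := fun c γ => by
        ext t
        exact intervalIntegral.integral_smul c _ } 1 (by
    intro γ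
    rw [one_mul, ContinuousMap.norm_le _ (by positivity)]
    intro t
    have := intervalIntegral.norm_integral_le_of_norm_le_const (a := 0) (b := (t : ℝ))
      (f := IccExtend zero_le_one γ) (C := ‖γ‖)
      (fun s _ => γ.norm_coe_le_norm _)
    refine this.trans ?_
    have h1 := t.2.1
    have h2 := t.2.2
    rw [sub_zero, abs_of_nonneg h1]
    exact mul_le_of_le_one_right (norm_nonneg _) h2)

theorem integ_apply {E : Type} [NormedAddCommGroup E] [NormedSpace ℝ E] [CompleteSpace E]
    (γ : C(I, E)) (t : I) :
    integ E γ t = ∫ s in (0:ℝ)..t, IccExtend zero_le_one γ s := rfl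

theorem norm_integ_le {E : Type} [NormedAddCommGroup E] [NormedSpace ℝ E] [CompleteSpace E]
    (γ : C(I, E)) : ‖integ E γ‖ ≤ ‖γ‖ := by
  have := (integ E).le_of_opNorm_le (LinearMap.mkContinuous_norm_le _ zero_le_one _) γ
  rwa [one_mul] at this

end MorseArea


namespace MorseArea
open scoped ContDiff Topology unitInterval NNReal
open MeasureTheory Filter

theorem flow_exists {E : Type} [NormedAddCommGroup E] [NormedSpace ℝ E] [FiniteDimensional ℝ E]
    (V : E → E) (hV : ContDiff ℝ ∞ V) (hL : LipschitzWith (1/2) V) :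
    ∃ φ : E → E, ContDiff ℝ ∞ φ ∧ ∀ x, ∃ γ : ℝ → E, γ 0 = x ∧ γ 1 = φ x ∧
      ∀ t ∈ Icc (0:ℝ) 1, HasDerivAt γ (V (γ t)) t := by
  have : CompleteSpace E := FiniteDimensional.complete ℝ E
  let N : C(I, E) → C(I, E) := nem V hV.continuous
  have hN : ContDiff ℝ ∞ N := contDiff_nem V hV
  let G : C(I, E) → C(I, E) := fun γ => γ - integ E (N γ)
  have hG : ContDiff ℝ ∞ G := contDiff_id.sub ((integ E).contDiff.comp hN)
  have hNl : ∀ γ η, ‖N γ - N η‖ ≤ (1/2) * ‖γ - η‖ := by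
    intro γ η
    rw [ContinuousMap.norm_le _ (by positivity)]
    intro t
    have h1 := hL.dist_le_mul (γ t) (η t)
    rw [dist_eq_norm, dist_eq_norm] at h1
    have h2 := (γ - η).norm_coe_le_norm t
    simp only [ContinuousMap.sub_apply] at h2
    have h3 : ‖V (γ t) - V (η t)‖ ≤ (1/2) * ‖γ t - η t‖ := by simpa using h1
    calc _ = ‖V (γ t) - V (η t)‖ := rfl
      _ ≤ _ := by linarith
  have happ : ApproximatesLinearOn G
      ((ContinuousLinearEquiv.refl ℝ C(I, E) : C(I, E) ≃L[ℝ] C(I, E)) :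
        C(I, E) →L[ℝ] C(I, E)) univ (1/2) := by
    intro γ _ η _
    have : G γ - G η - (γ - η) = - integ E (N γ - N η) := by
      simp only [G, map_sub]; abel
    simp only [ContinuousLinearEquiv.coe_refl, ContinuousLinearMap.coe_id', id_eq]
    rw [this, norm_neg]
    refine (norm_integ_le _).trans ?_
    simpa using hNl γ η
  have hc : Subsingleton C(I, E) ∨ (1/2 : ℝ≥0) <
      ‖((ContinuousLinearEquiv.refl ℝ C(I, E)).symm : C(I, E) →L[ℝ] C(I, E))‖₊⁻¹ := by
    rcases subsingleton_or_nontrivial C(I, E) with h | h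
    · exact Or.inl h
    · right
      have : ‖((ContinuousLinearEquiv.refl ℝ C(I, E)).symm : C(I, E) →L[ℝ] C(I, E))‖₊ = 1 := by
        ext
        exact ContinuousLinearMap.norm_id
      rw [this, inv_one]
      exact NNReal.half_lt_self one_ne_zero
  let H : C(I, E) ≃ₜ C(I, E) := happ.toHomeomorph G hc
  have hHG : ⇑H = G := rfl
  let D : C(I, E) → (C(I, E) →L[ℝ] C(I, E)) := fun γ => 
    (integ E).comp (appl E E (nem (fderiv ℝ V) (hV.continuous_fderiv (by simp)) γ))
  have hD : ∀ γ, ‖D γ‖ < 1 := by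
    intro γ
    refine lt_of_le_of_lt (b := 1/2) ?_ (by norm_num)
    refine ContinuousLinearMap.opNorm_le_bound _ (by norm_num) fun η => ?_
    refine (norm_integ_le _).trans ?_
    rw [ContinuousMap.norm_le _ (by positivity)]
    intro t
    have h1 : ‖fderiv ℝ V (γ t)‖ ≤ 1/2 := by
      simpa using norm_fderiv_le_of_lipschitz ℝ (x₀ := γ t) hL
    exact (fderiv ℝ V (γ t)).le_of_opNorm_le_of_le h1 (η.norm_coe_le_norm t)
  let D' : C(I, E) → (C(I, E) ≃L[ℝ] C(I, E)) := fun γ =>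
    ContinuousLinearEquiv.unitsEquiv ℝ _ (Units.oneSub (D γ) (hD γ))
  have hGd : ∀ γ, HasFDerivAt H (D' γ : C(I, E) →L[ℝ] C(I, E)) γ := by
    intro γ
    have h1 : HasFDerivAt G (ContinuousLinearMap.id ℝ C(I, E) - D γ) γ :=
      (hasFDerivAt_id γ).sub
        ((integ E).hasFDerivAt.comp γ (hasFDerivAt_nem V (hV.of_le (by simp)) γ))
    exact h1
  have hHs : ContDiff ℝ ∞ H.symm := Homeomorph.contDiff_symm H hGd (by rw [hHG]; exact hG)
  let cst : E →L[ℝ] C(I, E) := LinearMap.mkContinuous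
    { toFun := fun x => ContinuousMap.const I x
      map_add' := fun x y => by ext; simp
      map_smul' := fun c x => by ext; simp } 1 (by
      intro x
      rw [one_mul, ContinuousMap.norm_le _ (by positivity)]
      intro t
      simp)
  have hcst : ∀ x t, cst x t = x := fun x t => rfl
  refine ⟨fun x => H.symm (cst x) 1, ?_, ?_⟩
  · exact (ContinuousMap.evalCLM ℝ (1 : I)).contDiff.comp (hHs.comp cst.contDiff)
  · intro x
    set c := H.symm (cst x) with hcdef
    have hc1 : G c = cst x := H.apply_symm_apply _
    have hceq : ∀ t : I, c t = x + ∫ s in (0:ℝ)..t, IccExtend zero_le_one (N c) s := by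
      intro t
      have := DFunLike.congr_fun hc1 t
      rw [hcst] at this
      rw [← this, ← integ_apply]
      simp [G]
    have hcont : Continuous (IccExtend zero_le_one (N c)) :=
      (N c).continuous.Icc_extend' (h := zero_le_one)
    refine ⟨fun t => x + ∫ s in (0:ℝ)..t, IccExtend zero_le_one (N c) s, by simp, ?_, ?_⟩
    · exact (hceq 1).symm
    · intro t ht
      have h1 := (intervalIntegral.integral_hasDerivAt_right (hcont.intervalIntegrable 0 t)
        (hcont.stronglyMeasurableAtFilter _ _) hcont.continuousAt).const_add x
      convert h1 using 1
      rw [IccExtend_of_mem _ _ ht]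
      exact congrArg V (hceq ⟨t, ht⟩).symm

theorem ode_unique {E : Type} [NormedAddCommGroup E] [NormedSpace ℝ E] {C : ℝ≥0}
    {V : E → E} (hL : LipschitzWith C V) {f g : ℝ → E}
    (hf : ∀ t ∈ Icc (0:ℝ) 1, HasDerivAt f (V (f t)) t)
    (hg : ∀ t ∈ Icc (0:ℝ) 1, HasDerivAt g (V (g t)) t) (h0 : f 0 = g 0) : 
    EqOn f g (Icc 0 1) :=
  ODE_solution_unique (v := fun _ => V) (fun _ => hL)
    (fun t ht => (hf t ht).continuousAt.continuousWithinAt)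
    (fun t ht => (hf t (Ico_subset_Icc_self ht)).hasDerivWithinAt)
    (fun t ht => (hg t ht).continuousAt.continuousWithinAt)
    (fun t ht => (hg t (Ico_subset_Icc_self ht)).hasDerivWithinAt) h0

theorem flow_diffeo {E : Type} [NormedAddCommGroup E] [NormedSpace ℝ E] [FiniteDimensional ℝ E]
    (V : E → E) (hV : ContDiff ℝ ∞ V) (hL : LipschitzWith (1/2) V) :
    ∃ φ φ' : E → E, ContDiff ℝ ∞ φ ∧ ContDiff ℝ ∞ φ' ∧ (∀ x, φ' (φ x) = x) ∧
      (∀ x, φ (φ' x) = x) ∧ ∀ x, ∃ γ : ℝ → E, γ 0 = x ∧ γ 1 = φ x ∧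
      ∀ t ∈ Icc (0:ℝ) 1, HasDerivAt γ (V (γ t)) t := by
  obtain ⟨φ, hφ, hc⟩ := flow_exists V hV hL
  have hL' : LipschitzWith (1/2) (fun x => - V x) := hL.neg
  obtain ⟨φ', hφ', hc'⟩ := flow_exists (fun x => - V x) hV.neg hL'
  have mem : ∀ t ∈ Icc (0:ℝ) 1, 1 - t ∈ Icc (0:ℝ) 1 := fun t ht =>
    ⟨by linarith [ht.2], by linarith [ht.1]⟩
  have h1 : (1:ℝ) ∈ Icc (0:ℝ) 1 := by simp
  refine ⟨φ, φ', hφ, hφ', ?_, ?_, hc⟩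
  · intro x
    obtain ⟨γ, g0, g1, gd⟩ := hc x
    obtain ⟨η, e0, e1, ed⟩ := hc' (φ x)
    have hr : ∀ t ∈ Icc (0:ℝ) 1, HasDerivAt (fun t => γ (1 - t)) (- V (γ (1 - t))) t := by
      intro t ht
      have := (gd _ (mem t ht)).scomp t ((hasDerivAt_id t).const_sub 1)
      simpa [Function.comp_def] using this
    have := ode_unique hL' hr ed (by simp [g1, e0]) h1
    simp only [sub_self] at this
    rw [← e1, ← this, g0]
  · intro x
    obtain ⟨γ, g0, g1, gd⟩ := hc' x
    obtain ⟨η, e0, e1, ed⟩ := hc (φ' x)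
    have hr : ∀ t ∈ Icc (0:ℝ) 1, HasDerivAt (fun t => γ (1 - t)) (V (γ (1 - t))) t := by
      intro t ht
      have := (gd _ (mem t ht)).scomp t ((hasDerivAt_id t).const_sub 1)
      simpa [Function.comp_def] using this
    have := ode_unique hL hr ed (by simp [g1, e0]) h1
    simp only [sub_self] at this
    rw [← e1, ← this, g0]

end MorseArea


/-! ### Part 3: Borel's lemma and Whitney's theorem on even functions -/
namespace MorseArea
open scoped ContDiff Topology NNReal
open Filter

theorem borel (a : ℕ → ℝ) : ∃ f : ℝ → ℝ, ContDiff ℝ ∞ f ∧ ∀ n, iteratedDeriv n f 0 = a n := by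
  let χ : ContDiffBump (0:ℝ) := ⟨1, 2, one_pos, one_lt_two⟩
  let u : ℕ → ℝ → ℝ := fun n x => (a n / n.factorial) * (x ^ n * χ x)
  have hu : ∀ n, ContDiff ℝ ∞ (u n) := fun n =>
    contDiff_const.mul ((contDiff_id.pow n).mul χ.contDiff)
  have hus : ∀ n, HasCompactSupport (u n) := fun n =>
    (χ.hasCompactSupport.mul_left).mul_left
  have hb : ∀ n k, ∃ B : ℝ, ∀ x, |iteratedDeriv k (u n) x| ≤ B := by
    intro n k
    obtain ⟨B, hB⟩ := ((hus n).iteratedFDeriv (𝕜 := ℝ) k).exists_bound_of_continuous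
      ((hu n).continuous_iteratedFDeriv (mod_cast le_top))
    refine ⟨B, fun x => ?_⟩
    have := hB x
    rwa [norm_iteratedFDeriv_eq_norm_iteratedDeriv, Real.norm_eq_abs] at this
  choose B hB using hb
  have hB0 : ∀ n k, 0 ≤ B n k := fun n k => (abs_nonneg _).trans (hB n k 0)
  let M : ℕ → ℝ := fun n => ∑ k ∈ Finset.range n, B n k
  have hM : ∀ n k, k < n → B n k ≤ M n := fun n k hk =>
    Finset.single_le_sum (f := B n) (fun i _ => hB0 n i) (Finset.mem_range.2 hk)
  have hM0 : ∀ n, 0 ≤ M n := fun n => Finset.sum_nonneg fun i _ => hB0 n i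
  let l : ℕ → ℝ := fun n => 1 + M n * 2 ^ n
  have hl : ∀ n, 1 ≤ l n := fun n => by
    have := mul_nonneg (hM0 n) (pow_nonneg zero_le_two n : (0:ℝ) ≤ 2 ^ n)
    simp only [l]; linarith
  let f : ℕ → ℝ → ℝ := fun n x => ((l n)⁻¹ ^ n) * u n (l n * x)
  have hf : ∀ n, ContDiff ℝ ∞ (f n) := fun n =>
    contDiff_const.mul ((hu n).comp (contDiff_const.mul contDiff_id))
  have hfd : ∀ n k x, iteratedDeriv k (f n) x =
      ((l n)⁻¹ ^ n) * ((l n) ^ k * iteratedDeriv k (u n) (l n * x)) := by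
    intro n k x
    have h1 := iteratedDeriv_comp_const_mul (n := k) (f := u n) ((hu n).of_le (mod_cast le_top)) (l n)
    have h2 := iteratedDeriv_const_mul_field (x := x) (n := k) ((l n)⁻¹ ^ n)
      (fun x => u n (l n * x))
    rw [h1] at h2
    exact h2
  let v : ℕ → ℕ → ℝ := fun k n => if k < n then (1/2) ^ n else
    ((l n)⁻¹ ^ n) * ((l n) ^ k * B n k)
  have hv : ∀ k : ℕ, Summable (v k) := by
    intro k
    rw [← summable_nat_add_iff (k + 1)]
    have : (fun n => v k (n + (k + 1))) = fun n => (1/2 : ℝ) ^ (n + (k+1)) := by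
      ext n
      have : k < n + (k + 1) := by omega
      simp [v, this]
    rw [this, summable_nat_add_iff (f := fun n => (1/2 : ℝ) ^ n) (k + 1)]
    exact summable_geometric_two
  have hfb : ∀ k n x, ‖iteratedFDeriv ℝ k (f n) x‖ ≤ v k n := by
    intro k n x
    have hl0 : 0 < l n := one_pos.trans_le (hl n)
    rw [norm_iteratedFDeriv_eq_norm_iteratedDeriv, Real.norm_eq_abs, hfd, abs_mul, abs_mul,
      abs_of_nonneg (by positivity : 0 ≤ (l n)⁻¹ ^ n), abs_of_nonneg (by positivity : 0 ≤ l n ^ k)]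
    have h1 : (l n)⁻¹ ^ n * (l n ^ k * |iteratedDeriv k (u n) (l n * x)|)
        ≤ (l n)⁻¹ ^ n * (l n ^ k * B n k) := by
      gcongr
      exact hB n k _
    refine h1.trans ?_
    by_cases hk : k < n
    · simp only [v, hk, if_true]
      obtain ⟨j, rfl⟩ := Nat.exists_eq_add_of_lt hk
      have h2 : (l (k + j + 1))⁻¹ ^ (k + j + 1) * (l (k + j + 1) ^ k * B (k + j + 1) k)
        = ((l (k + j + 1))⁻¹ ^ j) * (B (k + j + 1) k / l (k + j + 1)) := by
        have hl1 : l (k + j + 1) ≠ 0 := hl0.ne'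
        generalize l (k + j + 1) = c at hl1
        rw [inv_pow, inv_pow, pow_succ, pow_add]
        field_simp
      rw [h2]
      have h3 : (l (k + j + 1))⁻¹ ^ j ≤ 1 :=
        pow_le_one₀ (by positivity) (inv_le_one_of_one_le₀ (hl _))
      have h4 : B (k + j + 1) k / l (k + j + 1) ≤ (1/2) ^ (k + j + 1) := by
        rw [div_le_iff₀ hl0]
        have h5 := hM _ _ hk
        have h6 : (1/2 : ℝ) ^ (k + j + 1) * l (k + j + 1)
            = (1/2) ^ (k + j + 1) + M (k + j + 1) := by
          simp only [l]
          rw [mul_add, mul_one, mul_comm (M _), ← mul_assoc, ← mul_pow]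
          norm_num
        rw [h6]
        have : (0:ℝ) ≤ (1/2) ^ (k + j + 1) := by positivity
        linarith
      have h7 : 0 ≤ B (k + j + 1) k / l (k + j + 1) := div_nonneg (hB0 _ _) hl0.le
      exact (mul_le_of_le_one_left h7 h3).trans h4
    · simp only [v, hk, if_false]
      exact le_rfl
  refine ⟨fun x => ∑' n, f n x, ?_, ?_⟩
  · exact contDiff_tsum (N := ⊤) hf (fun k _ => hv k) (fun k n x _ => hfb k n x)
  · intro k
    have h1 := iteratedFDeriv_tsum_apply (N := ⊤) hf (fun k _ => hv k)
      (fun k n x _ => hfb k n x) (k := k) le_top 0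
    have hsum : Summable fun n => iteratedFDeriv ℝ k (f n) 0 :=
      Summable.of_norm_bounded (hv k) (fun n => hfb k n 0)
    have h2 : iteratedDeriv k (fun x => ∑' n, f n x) 0 = ∑' n, iteratedDeriv k (f n) 0 := by
      rw [iteratedDeriv_eq_iteratedFDeriv, h1]
      have := (ContinuousMultilinearMap.apply ℝ (fun _ : Fin k => ℝ) ℝ
        (fun _ => (1:ℝ))).map_tsum hsum
      simpa [iteratedDeriv_eq_iteratedFDeriv] using this
    rw [h2, tsum_eq_single k]
    · have hl0 : 0 < l k := one_pos.trans_le (hl k)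
      rw [hfd, mul_zero]
      have he : u k =ᶠ[𝓝 0] fun x => (a k / k.factorial) * (x ^ k) := by
        filter_upwards [χ.eventuallyEq_one] with x hx
        simp only [u, hx, Pi.one_apply, mul_one]
      rw [he.iteratedDeriv_eq, iteratedDeriv_const_mul_field, iteratedDeriv_fun_pow_zero]
      simp only [if_true]
      have : (k.factorial : ℝ) ≠ 0 := by positivity
      have hl1 : l k ≠ 0 := hl0.ne'
      generalize l k = c at hl1
      rw [inv_pow]
      field_simp
    · intro n hn
      rw [hfd, mul_zero]
      have he : u n =ᶠ[𝓝 0] fun x => (a n / n.factorial) * (x ^ n) := by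
        filter_upwards [χ.eventuallyEq_one] with x hx
        simp only [u, hx, Pi.one_apply, mul_one]
      rw [he.iteratedDeriv_eq, iteratedDeriv_const_mul_field, iteratedDeriv_fun_pow_zero]
      simp [hn.symm]

theorem even_step (m : ℝ → ℝ) (hm : ContDiff ℝ ∞ m) (he : ∀ r, m (-r) = m r) :
    ∃ q : ℝ → ℝ, ContDiff ℝ ∞ q ∧ (∀ r, q (-r) = q r) ∧ ∀ r, deriv m r = 2 * r * q r := by
  have hm1 : ContDiff ℝ ∞ (deriv m) := (contDiff_infty_iff_deriv.1 hm).2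
  have hm2 : ContDiff ℝ ∞ (deriv (deriv m)) := (contDiff_infty_iff_deriv.1 hm1).2
  have ho : ∀ r, deriv m (-r) = - deriv m r := by
    intro r
    have h := deriv_comp_neg (f := m) r
    have h2 : (fun x => m (-x)) = m := funext he
    rw [h2] at h
    linarith
  have h0 : deriv m 0 = 0 := by
    have := ho 0
    rw [neg_zero] at this
    linarith
  have he2 : ∀ r, deriv (deriv m) (-r) = deriv (deriv m) r := by
    intro r
    have h := deriv_comp_neg (f := deriv m) r
    have h2 : (fun x => deriv m (-x)) = fun x => - deriv m x := funext ho
    rw [h2, deriv.fun_neg] at h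
    linarith
  refine ⟨fun r => ∫ t in (0:ℝ)..1, (1/2) * deriv (deriv m) (t * r),
    contDiff_paramInt (fun q : ℝ × ℝ => (1/2) * deriv (deriv m) (q.2 * q.1))
      (contDiff_const.mul (hm2.comp (contDiff_snd.mul contDiff_fst))) 0 1, ?_, ?_⟩
  · intro r
    simp only [mul_neg, he2]
  · intro r
    have hc : Continuous fun t : ℝ => deriv (deriv m) (t * r) := by
      have := hm2.continuous
      fun_prop
    have h1 : ∀ t ∈ uIcc (0:ℝ) 1,
        HasDerivAt (fun t : ℝ => deriv m (t * r)) (deriv (deriv m) (t * r) * r) t := by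
      intro t _
      have h := (hm1.differentiable (by simp) (t * r)).hasDerivAt
      exact h.comp t (by simpa using (hasDerivAt_id t).mul_const r)
    have h2 := intervalIntegral.integral_eq_sub_of_hasDerivAt h1
      ((hc.mul_const r).intervalIntegrable _ _)
    rw [intervalIntegral.integral_mul_const] at h2
    beta_reduce
    rw [intervalIntegral.integral_const_mul]
    simp only [one_mul, zero_mul, h0, sub_zero] at h2
    linarith

theorem whitney_even (m : ℝ → ℝ) (hm : ContDiff ℝ ∞ m) (he : ∀ r, m (-r) = m r) :
    ∃ h : ℝ → ℝ, ContDiff ℝ ∞ h ∧ ∀ r, h (r ^ 2) = m r := by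
  choose! D hD1 hD2 hD3 using even_step
  let q : ℕ → ℝ → ℝ := fun n => D^[n] m
  have hqs : ∀ n, q (n + 1) = D (q n) := fun n => Function.iterate_succ_apply' D n m
  have hq : ∀ n, ContDiff ℝ ∞ (q n) ∧ ∀ r, q n (-r) = q n r := by
    intro n
    induction n with
    | zero => exact ⟨hm, he⟩
    | succ n ih =>
      rw [hqs]
      exact ⟨hD1 _ ih.1 ih.2, hD2 _ ih.1 ih.2⟩
  have hqd : ∀ n r, deriv (q n) r = 2 * r * q (n + 1) r := by
    intro n r
    rw [hqs]
    exact hD3 _ (hq n).1 (hq n).2 r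
  obtain ⟨g, hg, hga⟩ := borel (fun n => q n 0)
  have hgd : ∀ n x, HasDerivAt (iteratedDeriv n g) (iteratedDeriv (n + 1) g x) x := by
    intro n x
    rw [iteratedDeriv_succ]
    exact ((hg.differentiable_iteratedDeriv n (by
      exact_mod_cast (WithTop.coe_lt_top n))) x).hasDerivAt
  have hgc : ∀ n, Continuous (iteratedDeriv n g) := fun n =>
    continuous_iff_continuousAt.2 fun x => (hgd n x).continuousAt
  let f : ℕ → ℝ → ℝ := fun n s => q n (Real.sqrt s) + iteratedDeriv n g (min s 0) - q n 0
  have hfc : ∀ n, Continuous (f n) := by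
    intro n
    have h1 := (hq n).1.continuous
    have h2 := hgc n
    have h3 := Real.continuous_sqrt
    simp only [f]
    fun_prop
  have hfp : ∀ n s, 0 ≤ s → f n s = q n (Real.sqrt s) := by
    intro n s hs
    simp only [f, min_eq_right hs, hga]; ring
  have hfn : ∀ n s, s ≤ 0 → f n s = iteratedDeriv n g s := by
    intro n s hs
    simp only [f, min_eq_left hs, Real.sqrt_eq_zero_of_nonpos hs]; ring
  have hfd : ∀ n s, HasDerivAt (f n) (f (n + 1) s) s := by
    intro n
    refine hasDerivAt_of_hasDerivAt_of_ne' (x := 0) ?_ (hfc n).continuousAt (hfc (n+1)).continuousAt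
    intro s hs
    rcases lt_or_gt_of_ne hs with h | h
    · rw [hfn _ _ h.le]
      refine (hgd n s).congr_of_eventuallyEq ?_
      filter_upwards [eventually_lt_nhds h] with y hy
      exact hfn n y hy.le
    · rw [hfp _ _ h.le]
      have hs0 := Real.sqrt_pos.2 h
      have h1 := ((hq n).1.differentiable (by simp) (Real.sqrt s)).hasDerivAt
      rw [hqd] at h1
      have h2 := h1.comp s (Real.hasDerivAt_sqrt h.ne')
      have h3 : 2 * Real.sqrt s * q (n + 1) (Real.sqrt s) * (1 / (2 * Real.sqrt s))
        = q (n + 1) (Real.sqrt s) := by field_simp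
      rw [h3] at h2
      refine h2.congr_of_eventuallyEq ?_
      filter_upwards [eventually_gt_nhds h] with y hy
      exact hfp n y (le_of_lt hy)
  have hsm : ∀ k : ℕ, ∀ n, ContDiff ℝ k (f n) := by
    intro k
    induction k with
    | zero => intro n; simpa using hfc n
    | succ k ih =>
      intro n
      push_cast
      rw [contDiff_succ_iff_deriv]
      refine ⟨fun s => (hfd n s).differentiableAt, by simp, ?_⟩
      have : deriv (f n) = f (n + 1) := funext fun s => (hfd n s).deriv
      rw [this]
      exact ih _
  refine ⟨f 0, contDiff_infty.2 fun k => hsm k 0, fun r => ?_⟩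
  rw [hfp _ _ (sq_nonneg r), Real.sqrt_sq_eq_abs]
  change m |r| = m r
  rcases abs_choice r with h | h <;> rw [h]
  exact he r

end MorseArea


/-! ### Part 4: correction of the angular coordinate -/
namespace MorseArea
open scoped ContDiff Topology NNReal
open Filter

theorem det_two (L : (ℝ × ℝ) →ₗ[ℝ] (ℝ × ℝ)) :
    LinearMap.det L = (L (1,0)).1 * (L (0,1)).2 - (L (0,1)).1 * (L (1,0)).2 := by
  rw [← LinearMap.det_toMatrix (Module.Basis.finTwoProd ℝ), Matrix.det_fin_two]
  simp [LinearMap.toMatrix_apply]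

/-- Rotation of the plane. -/
noncomputable def rot (s : ℝ) (w : ℝ × ℝ) : ℝ × ℝ :=
  (Real.cos s * w.1 - Real.sin s * w.2, Real.sin s * w.1 + Real.cos s * w.2)

/-- Harmonic oscillator symbol. -/
noncomputable def nrg (w : ℝ × ℝ) : ℝ := (w.1 ^ 2 + w.2 ^ 2) / 2

theorem rot_rot (s t : ℝ) (w : ℝ × ℝ) : rot s (rot t w) = rot (s + t) w := by
  simp only [rot, Real.cos_add, Real.sin_add]
  ext <;> simp only <;> ring

theorem rot_zero (w : ℝ × ℝ) : rot 0 w = w := by simp [rot]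

theorem rot_per (s : ℝ) (k : ℤ) (w : ℝ × ℝ) : rot (s + k * (2 * Real.pi)) w = rot s w := by
  simp [rot, Real.cos_add_int_mul_two_pi, Real.sin_add_int_mul_two_pi]

theorem rot_per1 (s : ℝ) (w : ℝ × ℝ) : rot (s + 2 * Real.pi) w = rot s w := by
  simpa using rot_per s 1 w

theorem nrg_rot (s : ℝ) (w : ℝ × ℝ) : nrg (rot s w) = nrg w := by
  simp only [nrg, rot]
  linear_combination ((w.1 ^ 2 + w.2 ^ 2) / 2) * Real.sin_sq_add_cos_sq s

theorem nrg_nonneg (w : ℝ × ℝ) : 0 ≤ nrg w := by unfold nrg; positivity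

theorem nrg_contDiff : ContDiff ℝ ∞ nrg := by unfold nrg; fun_prop

theorem rot_contDiff : ContDiff ℝ ∞ fun q : (ℝ × ℝ) × ℝ => rot q.2 q.1 := by
  unfold rot
  have := Real.contDiff_cos (n := ∞)
  have := Real.contDiff_sin (n := ∞)
  fun_prop

theorem polar (w : ℝ × ℝ) : ∃ s : ℝ, w = rot s (Real.sqrt (2 * nrg w), 0) := by
  refine ⟨Complex.arg ⟨w.1, w.2⟩, ?_⟩
  have h1 := Complex.norm_mul_cos_arg ⟨w.1, w.2⟩
  have h2 := Complex.norm_mul_sin_arg ⟨w.1, w.2⟩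
  have h3 : ‖(⟨w.1, w.2⟩ : ℂ)‖ = Real.sqrt (2 * nrg w) := by
    rw [Complex.norm_def, Complex.normSq_apply]
    congr 1
    simp only [nrg]; ring
  rw [h3] at h1 h2
  ext
  · simp only [rot]; dsimp only at h1; linarith
  · simp only [rot]; dsimp only at h2; linarith

theorem hasDerivAt_rot (s : ℝ) (w : ℝ × ℝ) :
    HasDerivAt (fun s => rot s w) (-(rot s w).2, (rot s w).1) s := by
  have h1 := Real.hasDerivAt_cos s
  have h2 := Real.hasDerivAt_sin s
  have h3 : HasDerivAt (fun s => rot s w) _ s := ((h1.mul_const w.1).sub (h2.mul_const w.2)).prodMk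
    ((h2.mul_const w.1).add (h1.mul_const w.2))
  refine h3.congr_deriv ?_
  simp only [rot]
  ext <;> simp only <;> ring

/-- Mean over circles. -/
noncomputable def mean (f : ℝ × ℝ → ℝ) (w : ℝ × ℝ) : ℝ :=
  (2 * Real.pi)⁻¹ * ∫ s in (0:ℝ)..(2 * Real.pi), f (rot s w)

theorem mean_contDiff {f : ℝ × ℝ → ℝ} (hf : ContDiff ℝ ∞ f) : ContDiff ℝ ∞ (mean f) :=
  contDiff_const.mul (contDiff_paramInt (fun q : (ℝ × ℝ) × ℝ => f (rot q.2 q.1))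
    (hf.comp rot_contDiff) _ _)

theorem int_shift (G : ℝ → ℝ) (hG : ∀ s, G (s + 2 * Real.pi) = G s) (a : ℝ) :
    ∫ s in a..(a + 2 * Real.pi), G s = ∫ s in (0:ℝ)..(2 * Real.pi), G s := by
  have h : Function.Periodic G (2 * Real.pi) := hG
  simpa using h.intervalIntegral_add_eq a 0

theorem mean_rot (f : ℝ × ℝ → ℝ) (a : ℝ) (w : ℝ × ℝ) : mean f (rot a w) = mean f w := by
  unfold mean
  congr 1
  simp only [rot_rot]
  rw [intervalIntegral.integral_comp_add_right (fun s => f (rot s w)), zero_add, add_comm]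
  exact int_shift _ (fun s => by rw [rot_per1]) a

/-- Angular primitive of a function with mean zero over circles. -/
noncomputable def angPrim (g : ℝ × ℝ → ℝ) (w : ℝ × ℝ) : ℝ :=
  (2 * Real.pi)⁻¹ * ∫ s in (0:ℝ)..(2 * Real.pi), s * g (rot s w)

theorem angPrim_contDiff {g : ℝ × ℝ → ℝ} (hg : ContDiff ℝ ∞ g) : ContDiff ℝ ∞ (angPrim g) :=
  contDiff_const.mul (contDiff_paramInt (fun q : (ℝ × ℝ) × ℝ => q.2 * g (rot q.2 q.1))
    (contDiff_snd.mul (hg.comp rot_contDiff)) _ _)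

theorem angPrim_deriv {g : ℝ × ℝ → ℝ} (hg : ContDiff ℝ ∞ g) (hm : ∀ w, mean g w = 0)
    (a : ℝ) (w : ℝ × ℝ) :
    HasDerivAt (fun a => angPrim g (rot a w)) (g (rot a w)) a := by
  have hpi : (2 * Real.pi) ≠ 0 := by positivity
  have hGc : Continuous fun s => g (rot s w) :=
    hg.continuous.comp (rot_contDiff.continuous.comp (by fun_prop : Continuous fun s => (w, s)))
  have hsGc : Continuous fun s => s * g (rot s w) := continuous_id.mul hGc
  have h0 : ∫ s in (0:ℝ)..(2 * Real.pi), g (rot s w) = 0 := by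
    have := hm w
    unfold mean at this
    exact (mul_eq_zero.1 this).resolve_left (inv_ne_zero hpi)
  have h1 : ∀ a, angPrim g (rot a w) = (2 * Real.pi)⁻¹ *
      ((∫ s in (0:ℝ)..(a + 2 * Real.pi), s * g (rot s w)) - ∫ s in (0:ℝ)..a, s * g (rot s w)) := by
    intro a
    unfold angPrim
    congr 1
    simp only [rot_rot]
    have e1 := intervalIntegral.integral_comp_add_right (a := 0) (b := 2 * Real.pi)
      (fun s => (s - a) * g (rot s w)) a
    simp only [add_sub_cancel_right, zero_add] at e1
    rw [e1, add_comm (2 * Real.pi) a]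
    rw [intervalIntegral.integral_interval_sub_left (hsGc.intervalIntegrable _ _)
      (hsGc.intervalIntegrable _ _)]
    have e2 : ∫ s in a..(a + 2 * Real.pi), a * g (rot s w) = 0 := by
      rw [intervalIntegral.integral_const_mul, int_shift _ (fun s => by rw [rot_per1]) a, h0,
        mul_zero]
    have haGc : Continuous fun s => a * g (rot s w) := continuous_const.mul hGc
    have e3 := intervalIntegral.integral_sub (μ := MeasureTheory.volume)
      (hsGc.intervalIntegrable a (a + 2 * Real.pi))
      (haGc.intervalIntegrable a (a + 2 * Real.pi))
    rw [e2, sub_zero] at e3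
    rw [← e3]
    congr 1
    ext s
    ring
  have hd : ∀ b, HasDerivAt (fun b => ∫ s in (0:ℝ)..b, s * g (rot s w)) (b * g (rot b w)) b :=
    fun b => intervalIntegral.integral_hasDerivAt_right (hsGc.intervalIntegrable _ _)
      (hsGc.stronglyMeasurableAtFilter _ _) hsGc.continuousAt
  have hd2 := ((hd (a + 2 * Real.pi)).comp_add_const a (2 * Real.pi)).sub (hd a)
  have hd3 := hd2.const_mul (2 * Real.pi)⁻¹
  rw [rot_per1] at hd3
  have e4 : (2 * Real.pi)⁻¹ * ((a + 2 * Real.pi) * g (rot a w) - a * g (rot a w)) = g (rot a w) := by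
    field_simp; ring
  rw [e4] at hd3
  exact hd3.congr_of_eventuallyEq (Eventually.of_forall h1)

end MorseArea


namespace MorseArea
open scoped ContDiff Topology NNReal
open Filter

theorem contDiff_differentiableAt {E F : Type*} [NormedAddCommGroup E] [NormedSpace ℝ E]
    [NormedAddCommGroup F] [NormedSpace ℝ F] {f : E → F} (hf : ContDiff ℝ ∞ f) (x : E) :
    DifferentiableAt ℝ f x := hf.differentiable (by simp) x

theorem radial_profile (J : ℝ × ℝ → ℝ) (hJ : ContDiff ℝ ∞ J) (hpos : ∀ w, 0 < J w) :
    ∃ m q : ℝ → ℝ, ContDiff ℝ ∞ m ∧ ContDiff ℝ ∞ q ∧ (∀ w, m (nrg w) = mean J w) ∧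
      (∀ u, 0 ≤ u → 0 < m u) ∧ (∀ u, 0 ≤ u → 0 < q u) ∧ m 0 = J 0 ∧
      (∀ u, HasDerivAt (fun u => u * q u) (m u) u) := by
  have hM := mean_contDiff hJ
  have hMpos : ∀ w, 0 < mean J w := by
    intro w
    unfold mean
    have hc : Continuous fun s => J (rot s w) :=
      hJ.continuous.comp (rot_contDiff.continuous.comp (by fun_prop : Continuous fun s => (w, s)))
    have := intervalIntegral.intervalIntegral_pos_of_pos (hc.intervalIntegrable 0 (2 * Real.pi))
      (fun s => hpos _) (by positivity)
    positivity
  obtain ⟨h, hh, hhe⟩ := whitney_even (fun r => mean J (r, 0))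
    (hM.comp (contDiff_id.prodMk contDiff_const)) (by
      intro r
      have : ((-r, 0) : ℝ × ℝ) = rot Real.pi (r, 0) := by simp [rot]
      rw [this, mean_rot])
  have hmM : ∀ w, h (2 * nrg w) = mean J w := by
    intro w
    obtain ⟨s, hs⟩ := polar w
    conv_rhs => rw [hs, mean_rot]
    rw [← hhe, Real.sq_sqrt (by have := nrg_nonneg w; positivity)]
  have hmp : ∀ u, 0 ≤ u → 0 < h (2 * u) := by
    intro u hu
    have : nrg (Real.sqrt (2 * u), 0) = u := by
      simp only [nrg]
      rw [Real.sq_sqrt (by positivity)]; ring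
    rw [← this, hmM]
    exact hMpos _
  have hm : ContDiff ℝ ∞ fun u => h (2 * u) := hh.comp (contDiff_const.mul contDiff_id)
  refine ⟨fun u => h (2 * u), fun u => ∫ t in (0:ℝ)..1, h (2 * (t * u)), hm,
    contDiff_paramInt (fun q : ℝ × ℝ => h (2 * (q.2 * q.1))) (by fun_prop) 0 1, hmM, hmp,
    ?_, ?_, ?_⟩
  · intro u hu
    have hc : Continuous fun t : ℝ => h (2 * (t * u)) := by
      have := hh.continuous
      fun_prop
    refine intervalIntegral.intervalIntegral_pos_of_pos_on (hc.intervalIntegrable _ _) ?_ one_pos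
    intro t ht
    exact hmp _ (mul_nonneg ht.1.le hu)
  · have : nrg (0, 0) = 0 := by simp [nrg]
    beta_reduce
    rw [← this, hmM, mean]
    have : ∀ s, rot s (0, 0) = 0 := by intro s; simp [rot]
    simp only [this, intervalIntegral.integral_const, sub_zero, smul_eq_mul]
    field_simp
  · intro u
    have hd : HasDerivAt (fun b => ∫ s in (0:ℝ)..b, h (2 * s)) (h (2 * u)) u :=
      intervalIntegral.integral_hasDerivAt_right (hm.continuous.intervalIntegrable _ _)
        (hm.continuous.stronglyMeasurableAtFilter _ _) hm.continuous.continuousAt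
    refine hd.congr_of_eventuallyEq (Eventually.of_forall fun v => ?_)
    have := intervalIntegral.mul_integral_comp_mul_right (a := 0) (b := 1) (f := fun s => h (2 * s)) v
    simpa using this

theorem correction (J : ℝ × ℝ → ℝ) (hJ : ContDiff ℝ ∞ J) (hpos : ∀ w, 0 < J w) :
    ∃ (Ft : ℝ → ℝ) (Φ : ℝ × ℝ → ℝ × ℝ), ContDiff ℝ ∞ Ft ∧ ContDiff ℝ ∞ Φ ∧ Ft 0 = 0 ∧
      (∀ u, 0 ≤ u → 0 < deriv Ft u) ∧ deriv Ft 0 = J 0 ∧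
      (∀ w, LinearMap.det (fderiv ℝ Φ w : (ℝ × ℝ) →ₗ[ℝ] (ℝ × ℝ)) = J w) ∧
      (∀ w, nrg (Φ w) = Ft (nrg w)) ∧
      (∀ c, 0 ≤ c → BijOn Φ {w | nrg w ≤ c} {w | nrg w ≤ Ft c}) := by
  obtain ⟨m, q, hm, hq, hmM, hmp, hqp, hm0, hmd⟩ := radial_profile J hJ hpos
  have hMpos : ∀ w, 0 < mean J w := fun w => by rw [← hmM]; exact hmp _ (nrg_nonneg w)
  let g : ℝ × ℝ → ℝ := fun w => J w / mean J w - 1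
  have hg : ContDiff ℝ ∞ g :=
    (hJ.div (mean_contDiff hJ) (fun w => (hMpos w).ne')).sub contDiff_const
  have hgm : ∀ w, mean g w = 0 := by
    intro w
    have hc : Continuous fun s => J (rot s w) :=
      hJ.continuous.comp (rot_contDiff.continuous.comp (by fun_prop : Continuous fun s => (w, s)))
    have hne := (hMpos w).ne'
    have hI : ∫ s in (0:ℝ)..(2 * Real.pi), J (rot s w) = 2 * Real.pi * mean J w := by
      unfold mean
      field_simp
    have : mean g w = (2 * Real.pi)⁻¹ * ∫ s in (0:ℝ)..(2 * Real.pi),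
        (J (rot s w) / mean J w - 1) := by
      unfold mean
      simp only [g, mean_rot]
      rfl
    rw [this, intervalIntegral.integral_sub
      ((hc.div_const _).intervalIntegrable _ _) (by simp),
      intervalIntegral.integral_div, hI]
    simp
    field_simp
    simp
  let ψ := angPrim g
  have hψ : ContDiff ℝ ∞ ψ := angPrim_contDiff hg
  have hψd : ∀ s w, HasDerivAt (fun a => ψ (rot a w)) (g (rot s w)) s :=
    fun s w => angPrim_deriv hg hgm s w
  let R : ℝ × ℝ → ℝ := fun w => Real.sqrt (q (nrg w))
  have hqn : ∀ w, 0 < q (nrg w) := fun w => hqp _ (nrg_nonneg w)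
  have hR : ContDiff ℝ ∞ R := (hq.comp nrg_contDiff).sqrt (fun w => (hqn w).ne')
  have hRpos : ∀ w, 0 < R w := fun w => Real.sqrt_pos.2 (hqn w)
  have hR2 : ∀ w, R w ^ 2 = q (nrg w) := fun w => Real.sq_sqrt (hqn w).le
  have hRrot : ∀ s w, R (rot s w) = R w := fun s w => by simp only [R, nrg_rot]
  let Φ : ℝ × ℝ → ℝ × ℝ := fun w =>
    (R w * (Real.cos (ψ w) * w.1 - Real.sin (ψ w) * w.2),
     R w * (Real.sin (ψ w) * w.1 + Real.cos (ψ w) * w.2))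
  have hΦ : ContDiff ℝ ∞ Φ := by
    have h1 := hψ.cos
    have h2 := hψ.sin
    exact (hR.mul ((h1.mul contDiff_fst).sub (h2.mul contDiff_snd))).prodMk
      (hR.mul ((h2.mul contDiff_fst).add (h1.mul contDiff_snd)))
  let Ft : ℝ → ℝ := fun u => u * q u
  have hFt : ContDiff ℝ ∞ Ft := contDiff_id.mul hq
  have hFd : ∀ u, HasDerivAt Ft (m u) u := hmd
  have hΦn : ∀ w, nrg (Φ w) = Ft (nrg w) := by
    intro w
    have h1 : nrg (Φ w) = R w ^ 2 * nrg (rot (ψ w) w) := by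
      simp only [nrg, Φ, rot]; ring
    rw [h1, nrg_rot, hR2, mul_comm]
  have hFmono : StrictMonoOn Ft (Ici 0) := by
    refine strictMonoOn_of_deriv_pos (convex_Ici 0) hFt.continuous.continuousOn ?_
    intro u hu
    rw [interior_Ici] at hu
    rw [(hFd u).deriv]
    exact hmp u (le_of_lt hu)
  have hF0 : Ft 0 = 0 := zero_mul _
  have hΦrot : ∀ s w, Φ (rot s w) = R w • rot (s + ψ (rot s w)) w := by
    intro s w
    have h1 : Φ (rot s w) = R (rot s w) • rot (ψ (rot s w)) (rot s w) := rfl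
    rw [h1, rot_rot, hRrot, add_comm]
  have hTd : ∀ w s, HasDerivAt (fun s => s + ψ (rot s w)) (J (rot s w) / mean J (rot s w)) s := by
    intro w s
    have := (hasDerivAt_id s).add (hψd s w)
    refine this.congr_deriv ?_
    simp only [g]; ring
  have hTm : ∀ w, StrictMono fun s => s + ψ (rot s w) := by
    intro w
    refine strictMono_of_deriv_pos fun s => ?_
    rw [(hTd w s).deriv]
    exact div_pos (hpos _) (hMpos _)
  have hTc : ∀ w, Continuous fun s => s + ψ (rot s w) := fun w =>
    continuous_iff_continuousAt.2 fun s => (hTd w s).continuousAt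
  refine ⟨Ft, Φ, hFt, hΦ, hF0, ?_, ?_, ?_, hΦn, ?_⟩
  · intro u hu
    rw [(hFd u).deriv]
    exact hmp u hu
  · rw [(hFd 0).deriv, hm0]
  · intro w
    have hψw := (contDiff_differentiableAt hψ w).hasFDerivAt
    have hx : HasFDerivAt (fun w : ℝ × ℝ => w.1) (ContinuousLinearMap.fst ℝ ℝ ℝ) w :=
      hasFDerivAt_fst
    have hy : HasFDerivAt (fun w : ℝ × ℝ => w.2) (ContinuousLinearMap.snd ℝ ℝ ℝ) w :=
      hasFDerivAt_snd
    have hN : HasFDerivAt nrg (w.1 • ContinuousLinearMap.fst ℝ ℝ ℝ +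
        w.2 • ContinuousLinearMap.snd ℝ ℝ ℝ) w := by
      have h := (((hx.pow 2).add (hy.pow 2)).mul_const (1/2))
      have h' : HasFDerivAt nrg _ w := h.congr_of_eventuallyEq
        (Eventually.of_forall fun v => by simp [nrg]; ring)
      refine h'.congr_fderiv ?_
      ext <;> simp
    have hqd := (contDiff_differentiableAt hq (nrg w)).hasDerivAt
    set q' := deriv q (nrg w)
    have hRd : HasFDerivAt R ((1 / (2 * R w)) • (q' • (w.1 • ContinuousLinearMap.fst ℝ ℝ ℝ +
        w.2 • ContinuousLinearMap.snd ℝ ℝ ℝ))) w :=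
      (hqd.comp_hasFDerivAt w hN).sqrt (hqn w).ne'
    have hcos := hψw.cos
    have hsin := hψw.sin
    have hΦd : HasFDerivAt Φ _ w := (hRd.mul ((hcos.mul hx).sub (hsin.mul hy))).prodMk
      (hRd.mul ((hsin.mul hx).add (hcos.mul hy)))
    have hang : w.1 * fderiv ℝ ψ w (0,1) - w.2 * fderiv ℝ ψ w (1,0) = J w / mean J w - 1 := by
      have h1 := hψd 0 w
      have hψw' : HasFDerivAt ψ (fderiv ℝ ψ w) (rot 0 w) := by rw [rot_zero]; exact hψw
      have h2 := hψw'.comp_hasDerivAt 0 (hasDerivAt_rot 0 w)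
      have h3 := h1.unique h2
      rw [rot_zero] at h3
      have h4 : ((-w.2, w.1) : ℝ × ℝ) = (-w.2) • ((1, 0) : ℝ × ℝ) + w.1 • ((0, 1) : ℝ × ℝ) := by
        ext <;> simp
      rw [h4, map_add, map_smul, map_smul] at h3
      simp only [smul_eq_mul, g] at h3
      linarith
    have hmq : m (nrg w) = q (nrg w) + nrg w * q' := by
      have h1 := (hasDerivAt_id (nrg w)).mul hqd
      have h2 := (hmd (nrg w)).unique h1
      simpa using h2
    rw [hΦd.fderiv, det_two]
    have hcs := Real.sin_sq_add_cos_sq (ψ w)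
    have hRw := (hRpos w).ne'
    have hR2w := hR2 w
    have hMw := (hMpos w).ne'
    have hJw : J w = m (nrg w) * (J w / mean J w) := by
      rw [hmM]; field_simp
    rw [hJw, hmq, ← hR2w]
    have hang' : J w / mean J w =
      1 + w.1 * fderiv ℝ ψ w (0,1) - w.2 * fderiv ℝ ψ w (1,0) := by linarith
    rw [hang']
    simp
    generalize fderiv ℝ ψ w (0,1) = b
    generalize fderiv ℝ ψ w (1,0) = a
    simp only [nrg]
    have hk : R w * ((R w)⁻¹ * 2⁻¹ * q') = q' / 2 := by field_simp
    linear_combination (R w ^ 2 + R w * ((R w)⁻¹ * 2⁻¹ * q') * (w.1 ^ 2 + w.2 ^ 2)) *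
      (1 + w.1 * b - w.2 * a) * hcs + (w.1 ^ 2 + w.2 ^ 2) * (1 + w.1 * b - w.2 * a) * hk
  · intro c hc
    refine ⟨?_, ?_, ?_⟩
    · intro w hw
      change nrg (Φ w) ≤ Ft c
      rw [hΦn]
      exact hFmono.monotoneOn (nrg_nonneg w) hc hw
    · intro w _ w' _ hww
      have h1 : nrg w = nrg w' := by
        refine hFmono.injOn (nrg_nonneg w) (nrg_nonneg w') ?_
        rw [← hΦn, ← hΦn, hww]
      obtain ⟨s, hs⟩ := polar w
      obtain ⟨s', hs'⟩ := polar w'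
      rw [← h1] at hs'
      set r := Real.sqrt (2 * nrg w) with hr
      have hr0 : 0 ≤ r := Real.sqrt_nonneg _
      rcases hr0.eq_or_lt with h0 | h0
      · rw [hs, hs', ← h0]
        simp [rot]
      · rw [hs, hs', hΦrot, hΦrot] at hww
        have h2 : rot (s + ψ (rot s (r, 0))) (r, 0) = rot (s' + ψ (rot s' (r, 0))) (r, 0) :=
          smul_right_injective _ (hRpos (r, 0)).ne' hww
        have h3 := congrArg Prod.fst h2
        have h4 := congrArg Prod.snd h2
        simp only [rot, mul_zero, sub_zero, add_zero] at h3 h4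
        have h3' := mul_right_cancel₀ h0.ne' h3
        have h4' := mul_right_cancel₀ h0.ne' h4
        obtain ⟨k, hk⟩ := Real.Angle.angle_eq_iff_two_pi_dvd_sub.1 (Real.Angle.cos_sin_inj h3' h4')
        have h5 : s = s' + k * (2 * Real.pi) := by
          apply (hTm (r, 0)).injective
          beta_reduce
          rw [rot_per]
          simp only [rot, mul_zero, sub_zero, add_zero] 
          linarith
        rw [hs, hs', h5, rot_per]
    · intro v hv
      have hv' : nrg v ≤ Ft c := hv
      obtain ⟨u, hu, hFu⟩ := intermediate_value_Icc hc hFt.continuous.continuousOn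
        (⟨by rw [hF0]; exact nrg_nonneg v, hv'⟩ : nrg v ∈ Icc (Ft 0) (Ft c))
      obtain ⟨β, hβ⟩ := polar v
      let e : ℝ × ℝ := (Real.sqrt (2 * u), 0)
      have he : nrg e = u := by
        simp only [nrg, e]
        rw [Real.sq_sqrt (by linarith [hu.1])]; ring
      let T : ℝ → ℝ := fun s => s + ψ (rot s e)
      have hTk : ∀ k : ℤ, T (k * (2 * Real.pi)) = T 0 + k * (2 * Real.pi) := by
        intro k
        have := rot_per 0 k e
        rw [zero_add] at this
        simp only [T, this]; ring
      have hpi : 0 < 2 * Real.pi := by positivity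
      let k : ℤ := ⌊(β - T 0) / (2 * Real.pi)⌋
      have hk1 : (k:ℝ) * (2 * Real.pi) ≤ β - T 0 := by
        rw [← le_div_iff₀ hpi]; exact Int.floor_le _
      have hk2 : β - T 0 ≤ ((k + 1 : ℤ) :ℝ) * (2 * Real.pi) := by
        rw [← div_le_iff₀ hpi]; push_cast; exact (Int.lt_floor_add_one _).le
      have hle : (k:ℝ) * (2 * Real.pi) ≤ ((k + 1 : ℤ) :ℝ) * (2 * Real.pi) := hk1.trans hk2
      obtain ⟨s, -, hs⟩ := intermediate_value_Icc hle (hTc e).continuousOn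
        (⟨by have := hTk k; simp only [T] at *; linarith,
          by have := hTk (k+1); simp only [T] at *; linarith⟩ : β ∈ Icc (T _) (T _))
      refine ⟨rot s e, ?_, ?_⟩
      · change nrg (rot s e) ≤ c
        rw [nrg_rot, he]; exact hu.2
      · rw [hΦrot]
        beta_reduce at hs
        rw [hs]
        have h1 : R e * Real.sqrt (2 * u) = Real.sqrt (2 * nrg v) := by
          rw [← hFu]
          simp only [R, Ft, he]
          rw [← Real.sqrt_mul (hqp u hu.1).le]
          congr 1; ring
        rw [hβ, ← h1]
        simp only [rot, e]
        ext <;> simp <;> ring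

end MorseArea


/-! ### Part 5: the Morse lemma near the critical point -/
namespace MorseArea
open scoped ContDiff Topology NNReal
open Filter

theorem local_diffeo (T : ℝ × ℝ → ℝ × ℝ) (S : Set (ℝ × ℝ)) (hS : IsOpen S)
    (hT : ContDiffOn ℝ ∞ T S) (z₀ : ℝ × ℝ) (hz₀ : z₀ ∈ S)
    (hdet : LinearMap.det (fderiv ℝ T z₀ : (ℝ × ℝ) →ₗ[ℝ] (ℝ × ℝ)) ≠ 0) :
    ∃ e : OpenPartialHomeomorph (ℝ × ℝ) (ℝ × ℝ), e.source ⊆ S ∧ z₀ ∈ e.source ∧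
      (∀ z, e z = T z) ∧ ContDiffOn ℝ ∞ e.symm e.target := by
  have hTat : ∀ z ∈ S, ContDiffAt ℝ ∞ T z := fun z hz => hT.contDiffAt (hS.mem_nhds hz)
  have hTd : ∀ z ∈ S, HasFDerivAt T (fderiv ℝ T z) z := fun z hz =>
    ((hTat z hz).differentiableAt (by simp)).hasFDerivAt
  have hc : ContinuousOn (fun z => LinearMap.det (fderiv ℝ T z : (ℝ × ℝ) →ₗ[ℝ] (ℝ × ℝ))) S :=
    ContinuousLinearMap.continuous_det.comp_continuousOn
      (hT.continuousOn_fderiv_of_isOpen hS (by simp))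
  let S' := S ∩ (fun z => LinearMap.det (fderiv ℝ T z : (ℝ × ℝ) →ₗ[ℝ] (ℝ × ℝ))) ⁻¹' {0}ᶜ
  have hS' : IsOpen S' := hc.isOpen_inter_preimage hS isOpen_compl_singleton
  let L : ∀ z, LinearMap.det (fderiv ℝ T z : (ℝ × ℝ) →ₗ[ℝ] (ℝ × ℝ)) ≠ 0 →
    ((ℝ × ℝ) ≃L[ℝ] (ℝ × ℝ)) := fun z hz =>
      (fderiv ℝ T z).toContinuousLinearEquivOfDetNeZero hz
  have hL : ∀ z hz, (L z hz : (ℝ × ℝ) →L[ℝ] (ℝ × ℝ)) = fderiv ℝ T z := fun z hz => by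
    ext <;> rfl
  have h0 : HasFDerivAt T (L z₀ hdet : (ℝ × ℝ) →L[ℝ] (ℝ × ℝ)) z₀ := by
    rw [hL]; exact hTd z₀ hz₀
  let e0 := (hTat z₀ hz₀).toOpenPartialHomeomorph T h0 (by simp)
  have he0 : ∀ z, e0 z = T z := fun z => rfl
  have hz0e : z₀ ∈ e0.source := (hTat z₀ hz₀).mem_toOpenPartialHomeomorph_source h0 (by simp)
  let e := e0.restrOpen S' hS'
  have hes : e.source = e0.source ∩ S' := rfl
  refine ⟨e, ?_, ?_, fun z => rfl, ?_⟩
  · rw [hes]; exact fun z hz => hz.2.1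
  · rw [hes]; exact ⟨hz0e, hz₀, hdet⟩
  · intro w hw
    have h1 := e.map_target hw
    have h2 : e.symm w ∈ S' := (hes ▸ h1 : e.symm w ∈ e0.source ∩ S').2
    have h2' : LinearMap.det (fderiv ℝ T (e.symm w) : (ℝ × ℝ) →ₗ[ℝ] (ℝ × ℝ)) ≠ 0 := h2.2
    have h3 : HasFDerivAt e (L _ h2' : (ℝ × ℝ) →L[ℝ] (ℝ × ℝ)) (e.symm w) := by
      rw [hL _ h2']; exact hTd _ h2.1
    exact (e.contDiffAt_symm hw h3 (hTat _ h2.1)).contDiffWithinAt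

theorem quad_form (P : ℝ × ℝ → ℝ) (hP : ContDiff ℝ ∞ P) (z₀ : ℝ × ℝ) (hcrit : fderiv ℝ P z₀ = 0) :
    ∃ a b c : ℝ × ℝ → ℝ, ContDiff ℝ ∞ a ∧ ContDiff ℝ ∞ b ∧ ContDiff ℝ ∞ c ∧
      (∀ v, P (z₀ + v) = P z₀ + (a v * v.1 ^ 2 + 2 * b v * v.1 * v.2 + c v * v.2 ^ 2) / 2) ∧
      ∀ u w, iteratedFDeriv ℝ 2 P z₀ ![u, w] =
        a 0 * u.1 * w.1 + b 0 * (u.1 * w.2 + u.2 * w.1) + c 0 * u.2 * w.2 := by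
  have hf : ContDiff ℝ ∞ fun v => P (z₀ + v) := hP.comp (contDiff_const.add contDiff_id)
  have hfd : ∀ v, fderiv ℝ (fun v => P (z₀ + v)) v = fderiv ℝ P (z₀ + v) := fun v =>
    fderiv_comp_add_left z₀
  obtain ⟨f₁, f₂, h1, h2, h3, h4, h5⟩ := hadamard2 _ hf
  rw [hfd, add_zero, hcrit] at h4 h5
  simp only [zero_apply] at h4 h5
  obtain ⟨f11, f12, g1, g2, g3, g4, g5⟩ := hadamard2 _ h1
  obtain ⟨f21, f22, k1, k2, k3, k4, k5⟩ := hadamard2 _ h2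
  refine ⟨fun v => 2 * f11 v, fun v => f12 v + f21 v, fun v => 2 * f22 v,
    contDiff_const.mul g1, g2.add k1, contDiff_const.mul k2, ?_, ?_⟩
  · intro v
    have := h3 v
    rw [g3, k3, h4, h5, add_zero] at this
    rw [this]; ring
  · intro u w
    rw [iteratedFDeriv_two_apply]
    simp only [Matrix.cons_val_zero, Matrix.cons_val_one]
    have hd : ∀ v, fderiv ℝ P (z₀ + v) w =
        v.1 * fderiv ℝ f₁ v w + f₁ v * w.1 + (v.2 * fderiv ℝ f₂ v w + f₂ v * w.2) := by
      intro v
      have hx : HasFDerivAt (fun w : ℝ × ℝ => w.1) (ContinuousLinearMap.fst ℝ ℝ ℝ) v :=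
        hasFDerivAt_fst
      have hy : HasFDerivAt (fun w : ℝ × ℝ => w.2) (ContinuousLinearMap.snd ℝ ℝ ℝ) v :=
        hasFDerivAt_snd
      have hd1 := (hx.mul (contDiff_differentiableAt h1 v).hasFDerivAt).add
        (hy.mul (contDiff_differentiableAt h2 v).hasFDerivAt)
      have hd2 := hd1.const_add (P (z₀ + 0))
      have hd3 : HasFDerivAt (fun v => P (z₀ + v)) _ v := hd2.congr_of_eventuallyEq
        (Eventually.of_forall fun v => (h3 v).trans (add_assoc _ _ _))
      rw [← hfd, hd3.fderiv]
      simp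
    have hF1 : ContDiff ℝ ∞ fun v => fderiv ℝ f₁ v w :=
      (h1.fderiv_right (by simp)).clm_apply contDiff_const
    have hF2 : ContDiff ℝ ∞ fun v => fderiv ℝ f₂ v w :=
      (h2.fderiv_right (by simp)).clm_apply contDiff_const
    have hx : HasFDerivAt (fun w : ℝ × ℝ => w.1) (ContinuousLinearMap.fst ℝ ℝ ℝ) 0 :=
      hasFDerivAt_fst
    have hy : HasFDerivAt (fun w : ℝ × ℝ => w.2) (ContinuousLinearMap.snd ℝ ℝ ℝ) 0 :=
      hasFDerivAt_snd
    have e1 := ((hx.mul (contDiff_differentiableAt hF1 0).hasFDerivAt).add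
      ((contDiff_differentiableAt h1 0).hasFDerivAt.mul_const w.1)).add
      ((hy.mul (contDiff_differentiableAt hF2 0).hasFDerivAt).add
      ((contDiff_differentiableAt h2 0).hasFDerivAt.mul_const w.2))
    have e2 : HasFDerivAt (fun v => fderiv ℝ P (z₀ + v) w) _ 0 :=
      e1.congr_of_eventuallyEq (Eventually.of_forall fun v => hd v)
    have hDP : ContDiff ℝ ∞ (fderiv ℝ P) := hP.fderiv_right (by simp)
    have e3 : HasFDerivAt (fun v => fderiv ℝ P (z₀ + v)) (fderiv ℝ (fderiv ℝ P) z₀) 0 := by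
      have := (contDiff_differentiableAt hDP (z₀ + 0)).hasFDerivAt
      have h := (hasFDerivAt_comp_add_left z₀).2 this
      simpa using h
    have e4 := e3.clm_apply (hasFDerivAt_const w (0 : ℝ × ℝ))
    have e5 := congrArg (fun L => L u) (e4.unique e2)
    have lin : ∀ (L : (ℝ × ℝ) →L[ℝ] ℝ) (u : ℝ × ℝ), L u = u.1 * L (1, 0) + u.2 * L (0, 1) := by
      intro L u
      have : u = u.1 • ((1, 0) : ℝ × ℝ) + u.2 • ((0, 1) : ℝ × ℝ) := by ext <;> simp
      conv_lhs => rw [this, map_add, map_smul, map_smul]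
      simp
    simp at e5
    rw [e5, lin (fderiv ℝ f₁ 0) u, lin (fderiv ℝ f₁ 0) w, lin (fderiv ℝ f₂ 0) u,
      lin (fderiv ℝ f₂ 0) w, g4, g5, k4, k5]
    ring

theorem morse_local (P : ℝ × ℝ → ℝ) (hP : ContDiff ℝ ∞ P) (z₀ : ℝ × ℝ)
    (hcrit : fderiv ℝ P z₀ = 0)
    (hH : ∀ v : ℝ × ℝ, v ≠ 0 → 0 < iteratedFDeriv ℝ 2 P z₀ ![v, v]) :
    ∃ e : OpenPartialHomeomorph (ℝ × ℝ) (ℝ × ℝ), z₀ ∈ e.source ∧ e z₀ = 0 ∧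
      ContDiffOn ℝ ∞ e e.source ∧ ContDiffOn ℝ ∞ e.symm e.target ∧
      (∀ z ∈ e.source, P z = P z₀ + nrg (e z)) ∧
      0 < LinearMap.det (fderiv ℝ e z₀ : (ℝ × ℝ) →ₗ[ℝ] (ℝ × ℝ)) ∧
      LinearMap.det (fderiv ℝ e z₀ : (ℝ × ℝ) →ₗ[ℝ] (ℝ × ℝ)) =
        Real.sqrt (iteratedFDeriv ℝ 2 P z₀ ![(1,0),(1,0)] *
            iteratedFDeriv ℝ 2 P z₀ ![(0,1),(0,1)]
          - (iteratedFDeriv ℝ 2 P z₀ ![(1,0),(0,1)])^2) := by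
  obtain ⟨a, b, c, ha, hb, hc, hPq, hHq⟩ := quad_form P hP z₀ hcrit
  have ha0 : 0 < a 0 := by
    have := hH (1, 0) (by simp)
    rw [hHq] at this
    simpa using this
  have hd0 : 0 < a 0 * c 0 - b 0 ^ 2 := by
    have := hH (-b 0, a 0) (by simp [ha0.ne'])
    rw [hHq] at this
    simp only at this
    have h2 : 0 < a 0 * (a 0 * c 0 - b 0 ^ 2) := by linarith
    exact (mul_pos_iff_of_pos_left ha0).1 h2
  let d : ℝ × ℝ → ℝ := fun v => a v * c v - b v ^ 2
  have hd : ContDiff ℝ ∞ d := (ha.mul hc).sub (hb.pow 2)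
  let τ : ℝ × ℝ → ℝ × ℝ := fun z => z - z₀
  have hτ : ContDiff ℝ ∞ τ := contDiff_id.sub contDiff_const
  let S : Set (ℝ × ℝ) := {z | 0 < a (τ z)} ∩ {z | 0 < d (τ z)}
  have hS : IsOpen S :=
    (isOpen_lt continuous_const (ha.comp hτ).continuous).inter
    (isOpen_lt continuous_const (hd.comp hτ).continuous)
  have hτ0 : τ z₀ = 0 := sub_self _
  have hzS : z₀ ∈ S := by
    refine ⟨?_, ?_⟩
    · change 0 < a (τ z₀); rw [hτ0]; exact ha0
    · change 0 < d (τ z₀); rw [hτ0]; exact hd0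
  let α : ℝ × ℝ → ℝ := fun z => Real.sqrt (a (τ z))
  let β : ℝ × ℝ → ℝ := fun z => b (τ z) / Real.sqrt (a (τ z))
  let γ : ℝ × ℝ → ℝ := fun z => Real.sqrt (d (τ z)) / Real.sqrt (a (τ z))
  have hα : ContDiffOn ℝ ∞ α S :=
    (ha.comp hτ).contDiffOn.sqrt (fun z hz => hz.1.ne')
  have hα0 : ∀ z ∈ S, 0 < Real.sqrt (a (τ z)) := fun z hz => Real.sqrt_pos.2 hz.1
  have hβ : ContDiffOn ℝ ∞ β S :=
    (hb.comp hτ).contDiffOn.div hα (fun z hz => (hα0 z hz).ne')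
  have hγ : ContDiffOn ℝ ∞ γ S :=
    ((hd.comp hτ).contDiffOn.sqrt (fun z hz => hz.2.ne')).div hα (fun z hz => (hα0 z hz).ne')
  let T : ℝ × ℝ → ℝ × ℝ := fun z =>
    (α z * (τ z).1 + β z * (τ z).2, γ z * (τ z).2)
  have hT : ContDiffOn ℝ ∞ T S := by
    have h1 : ContDiffOn ℝ ∞ (fun z => (τ z).1) S := (contDiff_fst.comp hτ).contDiffOn
    have h2 : ContDiffOn ℝ ∞ (fun z => (τ z).2) S := (contDiff_snd.comp hτ).contDiffOn
    exact ((hα.mul h1).add (hβ.mul h2)).prodMk (hγ.mul h2)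
  have hTn : ∀ z ∈ S, P z = P z₀ + nrg (T z) := by
    intro z hz
    have h1 := hPq (τ z)
    have h2 : z₀ + τ z = z := by simp [τ]
    rw [h2] at h1
    rw [h1]
    congr 1
    have e1 := Real.sq_sqrt (le_of_lt hz.1)
    have e2 := Real.sq_sqrt (le_of_lt hz.2)
    have e3 := (hα0 z hz).ne'
    simp only [nrg, T, α, β, γ]
    have e4 : a (τ z) ≠ 0 := ne_of_gt hz.1
    simp only [d] at e2 ⊢
    field_simp
    rw [e2, e1]
    ring
  have hTd : HasFDerivAt T ((α z₀ • ContinuousLinearMap.fst ℝ ℝ ℝ +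
      β z₀ • ContinuousLinearMap.snd ℝ ℝ ℝ).prod (γ z₀ • ContinuousLinearMap.snd ℝ ℝ ℝ)) z₀ := by
    have dd : ∀ {f : ℝ × ℝ → ℝ}, ContDiffOn ℝ ∞ f S → HasFDerivAt f (fderiv ℝ f z₀) z₀ :=
      fun h => ((h.contDiffAt (hS.mem_nhds hzS)).differentiableAt (by simp)).hasFDerivAt
    have hx : HasFDerivAt (fun z => (τ z).1) (ContinuousLinearMap.fst ℝ ℝ ℝ) z₀ :=
      hasFDerivAt_fst.sub_const z₀.1
    have hy : HasFDerivAt (fun z => (τ z).2) (ContinuousLinearMap.snd ℝ ℝ ℝ) z₀ :=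
      hasFDerivAt_snd.sub_const z₀.2
    have h : HasFDerivAt T _ z₀ :=
      (((dd hα).mul hx).add ((dd hβ).mul hy)).prodMk ((dd hγ).mul hy)
    refine h.congr_fderiv ?_
    rw [hτ0]
    simp
  have hdet : LinearMap.det (fderiv ℝ T z₀ : (ℝ × ℝ) →ₗ[ℝ] (ℝ × ℝ)) = Real.sqrt (d 0) := by
    rw [hTd.fderiv, det_two]
    have := (hα0 z₀ hzS).ne'
    simp only [α, β, γ, hτ0] at this ⊢
    simp
    field_simp
  have hdpos : 0 < Real.sqrt (d 0) := Real.sqrt_pos.2 hd0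
  obtain ⟨e, he1, he2, he3, he4⟩ := local_diffeo T S hS hT z₀ hzS (by rw [hdet]; exact hdpos.ne')
  have heT : (e : ℝ × ℝ → ℝ × ℝ) = T := funext he3
  refine ⟨e, he2, ?_, ?_, he4, ?_, ?_, ?_⟩
  · rw [he3]; simp [T, hτ0]
  · rw [heT]; exact hT.mono he1
  · intro z hz
    rw [he3]; exact hTn z (he1 hz)
  · rw [heT, hdet]; exact hdpos
  · rw [heT, hdet, hHq, hHq, hHq]
    congr 1
    simp [d]

end MorseArea


/-! ### Part 6: globalization and choice of levels -/
namespace MorseArea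
open scoped ContDiff Topology NNReal Manifold
open Filter

theorem extend_cutoff (Ω : Set (ℝ × ℝ)) (hΩ : IsOpen Ω) (f : ℝ × ℝ → ℝ)
    (hf : ContDiffOn ℝ ∞ f Ω) (K : Set (ℝ × ℝ)) (hK : IsCompact K) (hKΩ : K ⊆ Ω) (b : ℝ) :
    ∃ G : ℝ × ℝ → ℝ, ContDiff ℝ ∞ G ∧ (∀ z ∈ K, G =ᶠ[𝓝 z] f) ∧
      (∃ C, IsCompact C ∧ C ⊆ Ω ∧ ∀ z ∉ C, G z = b) ∧
      ∀ z, ∃ c ∈ Icc (0:ℝ) 1, G z = c * f z + (1 - c) * b := by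
  obtain ⟨t, ht, hKt, htΩ⟩ := exists_compact_between hK hΩ hKΩ
  obtain ⟨χ, h1, h2, h3⟩ := exists_contMDiffMap_one_nhds_of_subset_interior (n := ⊤)
    𝓘(ℝ, ℝ × ℝ) hK.isClosed hKt
  have hχ : ContDiff ℝ ∞ χ := contMDiff_iff_contDiff.1 χ.contMDiff
  let G : ℝ × ℝ → ℝ := fun z => χ z * f z + (1 - χ z) * b
  refine ⟨G, ?_, ?_, ⟨t, ht, htΩ, ?_⟩, fun z => ⟨χ z, h3 z, rfl⟩⟩
  · rw [contDiff_iff_contDiffAt]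
    intro z
    by_cases hz : z ∈ Ω
    · have hfz := hf.contDiffAt (hΩ.mem_nhds hz)
      exact (hχ.contDiffAt.mul hfz).add ((contDiffAt_const.sub hχ.contDiffAt).mul contDiffAt_const)
    · have hz' : z ∈ tᶜ := fun h => hz (htΩ h)
      refine (contDiffAt_const (c := b)).congr_of_eventuallyEq ?_
      filter_upwards [ht.isClosed.isOpen_compl.mem_nhds hz'] with y hy
      simp only [G, h2 y hy]; ring
  · intro z hz
    have := (mem_nhdsSet_iff_forall.1 h1) z hz
    filter_upwards [this] with y hy
    have hy' : χ y = 1 := hy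
    simp only [G, hy']; ring
  · intro z hz
    simp only [G, h2 z hz]; ring

theorem globalize (Ω : Set (ℝ × ℝ)) (hΩ : IsOpen Ω) (p : ℝ × ℝ → ℝ) (A : ℝ)
    (hp : ContDiffOn ℝ ∞ p Ω)
    (K : Set (ℝ × ℝ)) (hKdef : K = {z ∈ Ω | p z ≤ A}) (hKc : IsCompact K) :
    ∃ P : ℝ × ℝ → ℝ, ContDiff ℝ ∞ P ∧ (∀ z ∈ K, P =ᶠ[𝓝 z] p) ∧ (∀ z, P z ≤ A ↔ z ∈ K) ∧
      ∃ C, IsCompact C ∧ ∀ z ∉ C, P z = A + 1 := by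
  have hKΩ : K ⊆ Ω := by rw [hKdef]; exact fun z hz => hz.1
  obtain ⟨P, h1, h2, ⟨C, hC, hCΩ, h3⟩, h4⟩ := extend_cutoff Ω hΩ p hp K hKc hKΩ (A + 1)
  refine ⟨P, h1, h2, ?_, C, hC, h3⟩
  intro z
  constructor
  · intro hz
    by_contra hzK
    by_cases hzC : z ∈ C
    · have hzA : A < p z := by
        by_contra h
        exact hzK (by rw [hKdef]; exact ⟨hCΩ hzC, not_lt.1 h⟩)
      obtain ⟨c, hc, hP⟩ := h4 z
      rw [hP] at hz
      rcases hc.1.eq_or_lt with h | h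
      · rw [← h] at hz; linarith
      · nlinarith [mul_pos h (sub_pos.2 hzA), hc.2]
    · rw [h3 z hzC] at hz; linarith
  · intro hz
    rw [(h2 z hz).eq_of_nhds]
    rw [hKdef] at hz
    exact hz.2

theorem choose_eta (P : ℝ × ℝ → ℝ) (hP : ContDiff ℝ ∞ P) (A : ℝ) (C : Set (ℝ × ℝ))
    (hC : IsCompact C) (hPC : ∀ z ∉ C, P z = A + 1) (z₀ : ℝ × ℝ)
    (hz₀A : P z₀ < A) (huniq : ∀ z, P z ≤ A → fderiv ℝ P z = 0 → z = z₀) :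
    ∃ η, 0 < η ∧ η < 1 ∧ ∀ z, P z ≤ A + η → fderiv ℝ P z = 0 → z = z₀ := by
  let Cr : Set (ℝ × ℝ) := C ∩ ({z | fderiv ℝ P z = 0} ∩ {z | A ≤ P z})
  have hDP : Continuous (fderiv ℝ P) := hP.continuous_fderiv (by simp)
  have hCr : IsCompact Cr := hC.inter_right
    ((isClosed_eq hDP continuous_const).inter (isClosed_le continuous_const hP.continuous))
  have key : ∃ μ, 0 < μ ∧ ∀ z ∈ Cr, A + μ ≤ P z := by
    rcases Cr.eq_empty_or_nonempty with h | h
    · exact ⟨1, one_pos, by simp [h]⟩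
    · obtain ⟨y, hy, hmin⟩ := hCr.exists_isMinOn h hP.continuous.continuousOn
      have : A < P y := by
        have hyA : A ≤ P y := hy.2.2
        rcases hyA.eq_or_lt with h' | h'
        · have := huniq y h'.symm.le hy.2.1
          rw [this] at h'; linarith
        · exact h'
      exact ⟨P y - A, by linarith, fun z hz => by have := hmin hz; simp at this; linarith⟩
  obtain ⟨μ, hμ, hμ2⟩ := key
  refine ⟨min (μ / 2) (1 / 2), by positivity, by have := min_le_right (μ/2) (1/2 : ℝ); linarith, ?_⟩
  intro z hz hd
  have e1 := min_le_right (μ/2) (1/2 : ℝ)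
  have e2 := min_le_left (μ/2) (1/2 : ℝ)
  by_contra hne
  have hzA : A < P z := by
    by_contra h
    exact hne (huniq z (not_lt.1 h) hd)
  have hzC : z ∈ C := by
    by_contra h
    have := hPC z h
    linarith
  have := hμ2 z ⟨hzC, hd, hzA.le⟩
  linarith

theorem strict_min (P : ℝ × ℝ → ℝ) (hP : ContDiff ℝ ∞ P) (A : ℝ) (C : Set (ℝ × ℝ))
    (hC : IsCompact C) (hPC : ∀ z ∉ C, P z = A + 1) (z₀ : ℝ × ℝ)
    (hz₀A : P z₀ < A) (huniq : ∀ z, P z ≤ A → fderiv ℝ P z = 0 → z = z₀) :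
    ∀ z, z ≠ z₀ → P z₀ < P z := by
  have hz₀C : z₀ ∈ C := by
    by_contra h
    have := hPC z₀ h
    linarith
  obtain ⟨y, hy, hmin⟩ := hC.exists_isMinOn ⟨z₀, hz₀C⟩ hP.continuous.continuousOn
  have hle : ∀ z, P y ≤ P z := by
    intro z
    by_cases h : z ∈ C
    · exact hmin h
    · have : P y ≤ P z₀ := hmin hz₀C
      rw [hPC z h]; linarith
  have hmincrit : ∀ x, P x = P y → x = z₀ := by
    intro x hx
    have h1 : IsLocalMin P x := Eventually.of_forall fun z => by rw [hx]; exact hle z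
    exact huniq x (by have := hle z₀; linarith) h1.fderiv_eq_zero
  have hyz : y = z₀ := hmincrit y rfl
  subst hyz
  intro z hz
  rcases (hle z).eq_or_lt with h | h
  · exact absurd (hmincrit z h.symm) hz
  · exact h

theorem choose_delta (P : ℝ × ℝ → ℝ) (hP : ContDiff ℝ ∞ P) (A : ℝ) (C : Set (ℝ × ℝ))
    (hC : IsCompact C) (hPC : ∀ z ∉ C, P z = A + 1) (z₀ : ℝ × ℝ)
    (hz₀A : P z₀ < A) (hmin : ∀ z, z ≠ z₀ → P z₀ < P z) (S T : Set (ℝ × ℝ))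
    (hS : S ∈ 𝓝 z₀) (hT : T ∈ 𝓝 (0 : ℝ × ℝ)) :
    ∃ δ, 0 < δ ∧ P z₀ + δ < A ∧ (∀ z, P z ≤ P z₀ + δ → z ∈ S) ∧ (∀ w, nrg w ≤ δ → w ∈ T) := by
  have h1 : ∃ μ, 0 < μ ∧ ∀ z ∈ C \ interior S, P z₀ + μ ≤ P z := by
    rcases (C \ interior S).eq_empty_or_nonempty with h | h
    · exact ⟨1, one_pos, by simp [h]⟩
    · obtain ⟨y, hy, hm⟩ := (hC.diff isOpen_interior).exists_isMinOn h hP.continuous.continuousOn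
      have : P z₀ < P y := hmin y (fun h' => hy.2 (h' ▸ mem_interior_iff_mem_nhds.2 hS))
      exact ⟨P y - P z₀, by linarith, fun z hz => by have := hm hz; simp at this; linarith⟩
  obtain ⟨μ, hμ, hμ2⟩ := h1
  obtain ⟨r, hr, hrT⟩ := Metric.mem_nhds_iff.1 hT
  let δ := min (min (μ / 2) ((A - P z₀) / 2)) (r ^ 2 / 4)
  have hAz : 0 < A - P z₀ := by linarith
  have d1 : δ ≤ μ / 2 := (min_le_left _ _).trans (min_le_left _ _)
  have d2 : δ ≤ (A - P z₀) / 2 := (min_le_left _ _).trans (min_le_right _ _)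
  have d3 : δ ≤ r ^ 2 / 4 := min_le_right _ _
  refine ⟨δ, by positivity, by linarith, ?_, ?_⟩
  · intro z hz
    by_contra h
    have hzC : z ∈ C := by
      by_contra h'
      have := hPC z h'
      linarith
    have := hμ2 z ⟨hzC, fun h' => h (interior_subset h')⟩
    linarith
  · intro w hw
    apply hrT
    have e1 : (w.1 ^ 2 + w.2 ^ 2) / 2 ≤ r ^ 2 / 4 := hw.trans d3
    rw [mem_ball_zero_iff, Prod.norm_def, max_lt_iff, Real.norm_eq_abs, Real.norm_eq_abs]
    have hr2 : 0 < r ^ 2 := by positivity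
    constructor
    · exact abs_lt_of_sq_lt_sq (by nlinarith [sq_nonneg w.2]) hr.le
    · exact abs_lt_of_sq_lt_sq (by nlinarith [sq_nonneg w.1]) hr.le

end MorseArea


/-! ### Part 7: squeezing sublevel sets along the gradient flow -/
namespace MorseArea
open scoped ContDiff Topology NNReal
open Filter

/-- Data of one squeezing step. -/
theorem squeeze_field (P : ℝ × ℝ → ℝ) (hP : ContDiff ℝ ∞ P) (A : ℝ) (C : Set (ℝ × ℝ))
    (hC : IsCompact C) (hPC : ∀ z ∉ C, P z = A + 1) (z₀ : ℝ × ℝ) (η : ℝ) (hη : 0 < η)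
    (hη1 : η < 1) (huniq : ∀ z, P z ≤ A + η → fderiv ℝ P z = 0 → z = z₀)
    (c : ℝ) (hc : P z₀ < c) :
    ∃ (g : ℝ → ℝ) (V : ℝ × ℝ → ℝ × ℝ), ContDiff ℝ ∞ g ∧ ContDiff ℝ ∞ V ∧
      LipschitzWith (1/2) g ∧ LipschitzWith (1/2) V ∧ (∀ z, fderiv ℝ P z (V z) = g (P z)) ∧
      (∀ s ≤ c, g s = 0) ∧ (∀ s, g s ≤ 0) ∧ (∀ s, c < s → s ≤ A → g s < 0) ∧
      (∀ z, P z ≤ c → V z = 0) := by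
  let g : ℝ → ℝ := fun s => expNegInvGlue (s - c) * expNegInvGlue (A + η / 2 - s)
  have hg : ContDiff ℝ ∞ g :=
    (expNegInvGlue.contDiff.comp (contDiff_id.sub contDiff_const)).mul
      (expNegInvGlue.contDiff.comp (contDiff_const.sub contDiff_id))
  have hg1 : ∀ s ≤ c, g s = 0 := fun s hs => by
    simp only [g]; rw [expNegInvGlue.zero_of_nonpos (by linarith), zero_mul]
  have hg2 : ∀ s, A + η / 2 ≤ s → g s = 0 := fun s hs => by
    simp only [g]; rw [expNegInvGlue.zero_of_nonpos (x := A + η / 2 - s) (by linarith), mul_zero]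
  have hg3 : ∀ s, 0 ≤ g s := fun s => mul_nonneg (expNegInvGlue.nonneg _) (expNegInvGlue.nonneg _)
  have hg4 : ∀ s, c < s → s ≤ A → 0 < g s := fun s h1 h2 =>
    mul_pos (expNegInvGlue.pos_of_pos (by linarith)) (expNegInvGlue.pos_of_pos (by linarith))
  have hgs : HasCompactSupport g := by
    refine HasCompactSupport.intro (K := Icc c (A + η / 2)) isCompact_Icc ?_
    intro s hs
    by_cases h : s ≤ c
    · exact hg1 s h
    · refine hg2 s ?_
      by_contra h'
      exact hs ⟨(not_le.1 h).le, (not_le.1 h').le⟩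
  let X : ℝ × ℝ → ℝ := fun z => fderiv ℝ P z (1, 0)
  let Y : ℝ × ℝ → ℝ := fun z => fderiv ℝ P z (0, 1)
  have hX : ContDiff ℝ ∞ X := (hP.fderiv_right (by simp)).clm_apply contDiff_const
  have hY : ContDiff ℝ ∞ Y := (hP.fderiv_right (by simp)).clm_apply contDiff_const
  have hlin : ∀ z (u : ℝ × ℝ), fderiv ℝ P z u = u.1 * X z + u.2 * Y z := by
    intro z u
    have : u = u.1 • ((1, 0) : ℝ × ℝ) + u.2 • ((0, 1) : ℝ × ℝ) := by ext <;> simp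
    conv_lhs => rw [this, map_add, map_smul, map_smul]
    simp [X, Y]
  let D : ℝ × ℝ → ℝ := fun z => X z ^ 2 + Y z ^ 2
  have hD : ContDiff ℝ ∞ D := (hX.pow 2).add (hY.pow 2)
  have hD0 : ∀ z, D z = 0 → fderiv ℝ P z = 0 := by
    intro z hz
    have h1 : X z = 0 := by
      have := sq_nonneg (X z); have := sq_nonneg (Y z)
      exact pow_eq_zero_iff (two_ne_zero) |>.1 (by simp only [D] at hz; linarith)
    have h2 : Y z = 0 := by
      have := sq_nonneg (X z); have := sq_nonneg (Y z)
      exact pow_eq_zero_iff (two_ne_zero) |>.1 (by simp only [D] at hz; linarith)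
    ext <;> simp [hlin, h1, h2]
  let W : ℝ × ℝ → ℝ × ℝ := fun z => (g (P z) / D z) • (X z, Y z)
  have hgP : ContDiff ℝ ∞ fun z => g (P z) := hg.comp hP
  have hcase : ∀ z, D z = 0 → P z < c ∨ A + η / 2 < P z := by
    intro z hz
    by_cases h : P z ≤ A + η
    · left
      rw [huniq z h (hD0 z hz)]; exact hc
    · right; linarith
  have hW : ContDiff ℝ ∞ W := by
    rw [contDiff_iff_contDiffAt]
    intro z
    by_cases hz : D z = 0
    · have h0 : W =ᶠ[𝓝 z] fun _ => 0 := by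
        rcases hcase z hz with h | h
        · filter_upwards [hP.continuous.continuousAt.eventually (eventually_lt_nhds h)] with y hy
          simp [W, hg1 _ (le_of_lt hy)]
        · filter_upwards [hP.continuous.continuousAt.eventually (eventually_gt_nhds h)] with y hy
          simp [W, hg2 _ (le_of_lt hy)]
      exact contDiffAt_const.congr_of_eventuallyEq h0
    · exact (hgP.contDiffAt.div hD.contDiffAt hz).smul (hX.prodMk hY).contDiffAt
  have hWs : HasCompactSupport W := by
    refine HasCompactSupport.intro hC ?_
    intro z hz
    simp only [W]
    rw [hPC z hz, hg2 _ (by linarith)]; simp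
  have hWP : ∀ z, fderiv ℝ P z (W z) = g (P z) := by
    intro z
    rw [hlin]
    by_cases hz : D z = 0
    · have : g (P z) = 0 := by
        rcases hcase z hz with h | h
        · exact hg1 _ h.le
        · exact hg2 _ h.le
      simp [W, this]
    · simp only [W, Prod.smul_mk, smul_eq_mul]
      have e : X z * X z + Y z * Y z = D z := by simp only [D]; ring
      have : g (P z) / D z * X z * X z + g (P z) / D z * Y z * Y z = g (P z) / D z * D z := by
        rw [← e]; ring
      rw [this, div_mul_cancel₀ _ hz]
  obtain ⟨L1, hL1⟩ := hg.lipschitzWith_of_hasCompactSupport hgs (by simp)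
  obtain ⟨L2, hL2⟩ := hW.lipschitzWith_of_hasCompactSupport hWs (by simp)
  let ε : ℝ := 1 / (2 * (L1 + L2 + 1))
  have hε : 0 < ε := by positivity
  have lip : ∀ {E : Type} [NormedAddCommGroup E] [NormedSpace ℝ E] (f : E → E) (L : ℝ≥0),
      LipschitzWith L f → L ≤ L1 + L2 → LipschitzWith (1/2) (fun x => (-ε) • f x) := by
    intro E _ _ f L hf hL
    refine LipschitzWith.of_dist_le_mul fun x y => ?_
    rw [dist_smul₀, norm_neg, Real.norm_of_nonneg hε.le]
    have h1 := hf.dist_le_mul x y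
    have hL' : (L : ℝ) ≤ L1 + L2 := by exact_mod_cast hL
    have h2 : ε * L ≤ 1 / 2 := by
      simp only [ε]
      rw [div_mul_eq_mul_div, one_mul, div_le_iff₀ (by positivity)]
      linarith
    calc ε * dist (f x) (f y) ≤ ε * (L * dist x y) := by gcongr
      _ = (ε * L) * dist x y := by ring
      _ ≤ (1/2) * dist x y := by gcongr
      _ = _ := by norm_num
  refine ⟨fun s => (-ε) • g s, fun z => (-ε) • W z, hg.const_smul _, hW.const_smul _,
    lip g L1 hL1 (by simp), lip W L2 hL2 (by simp), ?_, ?_, ?_, ?_, ?_⟩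
  · intro z
    rw [map_smul, hWP]
  · intro s hs
    simp [hg1 s hs]
  · intro s
    have := mul_nonneg hε.le (hg3 s)
    simp only [smul_eq_mul]; linarith
  · intro s h1 h2
    have := mul_pos hε (hg4 s h1 h2)
    simp only [smul_eq_mul]; linarith
  · intro z hz
    simp [W, hg1 _ hz]

theorem squeeze_step (P : ℝ × ℝ → ℝ) (hP : ContDiff ℝ ∞ P) (A : ℝ) (C : Set (ℝ × ℝ))
    (hC : IsCompact C) (hPC : ∀ z ∉ C, P z = A + 1) (z₀ : ℝ × ℝ) (η : ℝ) (hη : 0 < η)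
    (hη1 : η < 1) (huniq : ∀ z, P z ≤ A + η → fderiv ℝ P z = 0 → z = z₀)
    (c : ℝ) (hc : P z₀ < c) :
    ∃ (φ φ' : ℝ × ℝ → ℝ × ℝ) (σ σ' : ℝ → ℝ), ContDiff ℝ ∞ φ ∧ ContDiff ℝ ∞ φ' ∧
      ContDiff ℝ ∞ σ ∧ ContDiff ℝ ∞ σ' ∧ (∀ x, φ' (φ x) = x) ∧ (∀ x, φ (φ' x) = x) ∧
      (∀ x, σ' (σ x) = x) ∧ (∀ x, σ (σ' x) = x) ∧ (∀ z, P (φ z) = σ (P z)) ∧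
      (∀ z, P z ≤ c → φ z = z) ∧ (∀ s ≤ c, σ s = s) ∧
      (∀ s, σ s ≤ s) ∧ (∀ s, c < s → s ≤ A → σ s < s) := by
  obtain ⟨g, V, hg, hV, hgL, hVL, hPV, hgc, hgn, hgs, hVc⟩ :=
    squeeze_field P hP A C hC hPC z₀ η hη hη1 huniq c hc
  obtain ⟨φ, φ', hφ, hφ', i1, i2, hφc⟩ := flow_diffeo V hV hVL
  obtain ⟨σ, σ', hσ, hσ', j1, j2, hσc⟩ := flow_diffeo g hg hgL
  have one : (1:ℝ) ∈ Icc (0:ℝ) 1 := by simp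
  have zero : (0:ℝ) ∈ Icc (0:ℝ) 1 := by simp
  have hanti : ∀ s, ∃ γ : ℝ → ℝ, γ 0 = s ∧ γ 1 = σ s ∧ AntitoneOn γ (Icc 0 1) ∧
      HasDerivAt γ (g s) 0 := by
    intro s
    obtain ⟨γ, h0, h1, hγ⟩ := hσc s
    refine ⟨γ, h0, h1, ?_, h0 ▸ hγ 0 zero⟩
    refine antitoneOn_of_deriv_nonpos (convex_Icc 0 1)
      (fun t ht => (hγ t ht).continuousAt.continuousWithinAt) ?_ ?_
    · intro t ht
      exact (hγ t (interior_subset ht)).differentiableAt.differentiableWithinAt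
    · intro t ht
      rw [(hγ t (interior_subset ht)).deriv]
      exact hgn _
  refine ⟨φ, φ', σ, σ', hφ, hφ', hσ, hσ', i1, i2, j1, j2, ?_, ?_, ?_, ?_, ?_⟩
  · intro z
    obtain ⟨γ, h0, h1, hγ⟩ := hφc z
    obtain ⟨θ, k0, k1, hθ⟩ := hσc (P z)
    have hd : ∀ t ∈ Icc (0:ℝ) 1, HasDerivAt (fun t => P (γ t)) (g (P (γ t))) t := by
      intro t ht
      have := (contDiff_differentiableAt hP (γ t)).hasFDerivAt.comp_hasDerivAt t (hγ t ht)
      rw [hPV] at this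
      exact this
    have := ode_unique hgL hd hθ (by rw [h0, k0]) one
    beta_reduce at this
    rw [← h1, this, k1]
  · intro z hz
    obtain ⟨γ, h0, h1, hγ⟩ := hφc z
    have hd : ∀ t ∈ Icc (0:ℝ) 1, HasDerivAt (fun _ : ℝ => z) (V z) t := by
      intro t _
      rw [hVc z hz]; exact hasDerivAt_const t z
    rw [← h1]
    exact ode_unique hVL hγ hd h0 one
  · intro s hs
    obtain ⟨γ, h0, h1, hγ⟩ := hσc s
    have hd : ∀ t ∈ Icc (0:ℝ) 1, HasDerivAt (fun _ : ℝ => s) (g s) t := by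
      intro t _
      rw [hgc s hs]; exact hasDerivAt_const t s
    rw [← h1]
    exact ode_unique hgL hγ hd h0 one
  · intro s
    obtain ⟨γ, h0, h1, hγ, -⟩ := hanti s
    rw [← h1]
    conv_rhs => rw [← h0]
    exact hγ zero one zero_le_one
  · intro s hs1 hs2
    obtain ⟨γ, h0, h1, hγ, hd⟩ := hanti s
    have hle : σ s ≤ s := by
      rw [← h1]
      conv_rhs => rw [← h0]
      exact hγ zero one zero_le_one
    refine lt_of_le_of_ne hle fun he => ?_
    have hconst : ∀ t ∈ Icc (0:ℝ) 1, γ t = s := by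
      intro t ht
      apply le_antisymm
      · rw [← h0]; exact hγ zero ht ht.1
      · rw [← he, ← h1]; exact hγ ht one ht.2
    have hd1 : HasDerivWithinAt γ (g s) (Icc 0 1) 0 := hd.hasDerivWithinAt
    have hd2 : HasDerivWithinAt γ 0 (Icc 0 1) 0 :=
      (hasDerivWithinAt_const (0:ℝ) (Icc (0:ℝ) 1) s).congr_of_mem hconst zero
    have := (uniqueDiffOn_Icc (zero_lt_one : (0:ℝ) < 1) 0 zero).eq_deriv _ hd1 hd2
    have h3 := hgs s hs1 hs2
    linarith

theorem squeeze (P : ℝ × ℝ → ℝ) (hP : ContDiff ℝ ∞ P) (A : ℝ) (C : Set (ℝ × ℝ))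
    (hC : IsCompact C) (hPC : ∀ z ∉ C, P z = A + 1) (z₀ : ℝ × ℝ) (η : ℝ) (hη : 0 < η)
    (hη1 : η < 1) (huniq : ∀ z, P z ≤ A + η → fderiv ℝ P z = 0 → z = z₀)
    (c : ℝ) (hc : P z₀ < c) (hcA : c < A) (l : ℝ) (hl : c < l) :
    ∃ (φ φ' : ℝ × ℝ → ℝ × ℝ) (σ : ℝ → ℝ), ContDiff ℝ ∞ φ ∧ ContDiff ℝ ∞ φ' ∧
      ContDiff ℝ ∞ σ ∧ (∀ x, φ' (φ x) = x) ∧ (∀ x, φ (φ' x) = x) ∧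
      (∀ z, P (φ z) = σ (P z)) ∧ (∀ z, P z ≤ c → φ z = z) ∧ (∀ s ≤ c, σ s = s) ∧
      StrictMono σ ∧ (∀ s, 0 < deriv σ s) ∧ σ A < l := by
  obtain ⟨φ, φ', σ, σ', hφ, hφ', hσ, hσ', i1, i2, j1, j2, hPφ, hφc, hσc, hle, hlt⟩ :=
    squeeze_step P hP A C hC hPC z₀ η hη hη1 huniq c hc
  have iter : ∀ {E : Type} [NormedAddCommGroup E] [NormedSpace ℝ E] (f : E → E),
      ContDiff ℝ ∞ f → ∀ n, ContDiff ℝ ∞ f^[n] := by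
    intro E _ _ f hf n
    induction n with
    | zero => exact contDiff_id
    | succ n ih => exact ih.comp hf
  have inv : ∀ {E : Type} (f f' : E → E), (∀ x, f' (f x) = x) → ∀ n x, f'^[n] (f^[n] x) = x := by
    intro E f f' h n
    exact Function.LeftInverse.iterate h n
  have fix : ∀ {E : Type} (f : E → E) (x : E), f x = x → ∀ n, f^[n] x = x := by
    intro E f x h n
    exact Function.iterate_fixed h n
  have mono : ∀ (f f' : ℝ → ℝ), ContDiff ℝ ∞ f → ContDiff ℝ ∞ f' → (∀ x, f' (f x) = x) →
      (∀ s ≤ c, f s = s) → StrictMono f ∧ ∀ s, 0 < deriv f s := by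
    intro f f' hf hf' hi hfc
    have hinj : Function.Injective f := Function.LeftInverse.injective hi
    have hm : StrictMono f := by
      rcases hf.continuous.strictMono_of_inj hinj with h | h
      · exact h
      · have h1 := h (show c - 1 < c by linarith)
        rw [hfc c le_rfl, hfc (c - 1) (by linarith)] at h1
        linarith
    refine ⟨hm, fun s => ?_⟩
    have h1 : 0 ≤ deriv f s := hm.monotone.deriv_nonneg
    refine lt_of_le_of_ne h1 fun h => ?_
    have h2 := (contDiff_differentiableAt hf s).hasDerivAt
    have h3 := (contDiff_differentiableAt hf' (f s)).hasDerivAt.comp s h2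
    have h4 : HasDerivAt (f' ∘ f) 1 s :=
      (hasDerivAt_id s).congr_of_eventuallyEq (Eventually.of_forall hi)
    have h5 := h3.unique h4
    rw [← h] at h5
    simp at h5
  obtain ⟨hm1, -⟩ := mono σ σ' hσ hσ' j1 hσc
  have hn : ∃ n, σ^[n] A < l := by
    have hge : ∀ n, c ≤ σ^[n] A := by
      intro n
      have := (hm1.iterate n).monotone hcA.le
      rwa [fix σ c (hσc c le_rfl) n] at this
    have hant : Antitone fun n => σ^[n] A := antitone_nat_of_succ_le fun n => by
      rw [Function.iterate_succ_apply']
      exact hle _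
    have hbdd : BddBelow (range fun n => σ^[n] A) := ⟨c, by rintro _ ⟨n, rfl⟩; exact hge n⟩
    have ht := tendsto_atTop_ciInf hant hbdd
    set y := ⨅ n, σ^[n] A with hy
    have hfix : σ y = y := isFixedPt_of_tendsto_iterate ht hσ.continuous.continuousAt
    have hyA : y ≤ A := ciInf_le hbdd 0
    have hyc : y ≤ c := by
      by_contra h
      have := hlt y (not_le.1 h) hyA
      linarith
    exact (ht.eventually (eventually_lt_nhds (hyc.trans_lt hl))).exists
  obtain ⟨n, hn⟩ := hn
  obtain ⟨hm, hd⟩ := mono σ^[n] σ'^[n] (iter σ hσ n) (iter σ' hσ' n) (inv σ σ' j1 n)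
    (fun s hs => fix σ s (hσc s hs) n)
  refine ⟨φ^[n], φ'^[n], σ^[n], iter φ hφ n, iter φ' hφ' n, iter σ hσ n, inv φ φ' i1 n,
    inv φ' φ i2 n, ?_, fun z hz => fix φ z (hφc z hz) n, fun s hs => fix σ s (hσc s hs) n,
    hm, hd, hn⟩
  intro z
  exact (Function.Semiconj.iterate_right (f := P) hPφ n) z

end MorseArea


/-! ### Part 8: assembly -/
namespace MorseArea
open scoped ContDiff Topology NNReal
open Filter

theorem det_contDiffOn (H : ℝ × ℝ → ℝ × ℝ) (T : Set (ℝ × ℝ)) (hT : IsOpen T)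
    (hH : ContDiffOn ℝ ∞ H T) :
    ContDiffOn ℝ ∞ (fun w => LinearMap.det (fderiv ℝ H w : (ℝ × ℝ) →ₗ[ℝ] (ℝ × ℝ))) T := by
  have h1 : ContDiffOn ℝ ∞ (fderiv ℝ H) T := hH.fderiv_of_isOpen hT (by simp)
  have h2 : ∀ v : ℝ × ℝ, ContDiffOn ℝ ∞ (fun w => fderiv ℝ H w v) T := fun v =>
    h1.clm_apply contDiffOn_const
  simp only [det_two]
  exact ((h2 (1,0)).fst.mul (h2 (0,1)).snd).sub ((h2 (0,1)).fst.mul (h2 (1,0)).snd)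

theorem det_chain {f g : ℝ × ℝ → ℝ × ℝ} {z : ℝ × ℝ} (hf : DifferentiableAt ℝ f (g z))
    (hg : DifferentiableAt ℝ g z) :
    LinearMap.det (fderiv ℝ (fun z => f (g z)) z : (ℝ × ℝ) →ₗ[ℝ] (ℝ × ℝ)) =
      LinearMap.det (fderiv ℝ f (g z) : (ℝ × ℝ) →ₗ[ℝ] (ℝ × ℝ)) *
      LinearMap.det (fderiv ℝ g z : (ℝ × ℝ) →ₗ[ℝ] (ℝ × ℝ)) := by
  have : fderiv ℝ (fun z => f (g z)) z = (fderiv ℝ f (g z)).comp (fderiv ℝ g z) :=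
    (hf.hasFDerivAt.comp z hg.hasFDerivAt).fderiv
  rw [this, ← LinearMap.det_comp]
  rfl

theorem isCompact_disc (R : ℝ) : IsCompact {w : ℝ × ℝ | nrg w ≤ R} := by
  refine Metric.isCompact_of_isClosed_isBounded
    (isClosed_le nrg_contDiff.continuous continuous_const) ?_
  refine (Metric.isBounded_closedBall (x := (0 : ℝ × ℝ)) (r := 2 * |R| + 1)).subset ?_
  intro w hw
  have hw' : (w.1 ^ 2 + w.2 ^ 2) / 2 ≤ R := hw
  have hR := le_abs_self R
  have hR0 := abs_nonneg R
  rw [mem_closedBall_zero_iff, Prod.norm_def, max_le_iff, Real.norm_eq_abs, Real.norm_eq_abs]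
  constructor
  · exact abs_le_of_sq_le_sq (by nlinarith [sq_nonneg w.2]) (by positivity)
  · exact abs_le_of_sq_le_sq (by nlinarith [sq_nonneg w.1]) (by positivity)

end MorseArea

open MorseArea Filter in
theorem stmt10 (Ω : Set (ℝ × ℝ)) (hΩ : IsOpen Ω) (p : ℝ × ℝ → ℝ) (A : ℝ)
    (hp : ContDiffOn ℝ (⊤ : ℕ∞) p Ω)
    (K : Set (ℝ × ℝ)) (hKdef : K = {z ∈ Ω | p z ≤ A}) (hKc : IsCompact K)
    (z₀ : ℝ × ℝ) (hz₀ : z₀ ∈ K) (hz₀A : p z₀ < A)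
    (hcrit : fderiv ℝ p z₀ = 0)
    (huniq : ∀ z ∈ K, fderiv ℝ p z = 0 → z = z₀)
    (hHess : ∀ v : ℝ × ℝ, v ≠ 0 → 0 < iteratedFDeriv ℝ 2 p z₀ ![v, v]) :
    ∃ (F : ℝ → ℝ) (Ψ : ℝ × ℝ → ℝ × ℝ) (U : Set (ℝ × ℝ)),
      ContDiff ℝ (⊤ : ℕ∞) F ∧ (∀ t ∈ Icc (p z₀) A, 0 < deriv F t) ∧ F (p z₀) = 0 ∧
      IsOpen U ∧ K ⊆ U ∧ U ⊆ Ω ∧ ContDiffOn ℝ (⊤ : ℕ∞) Ψ U ∧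
      Set.BijOn Ψ K {w : ℝ × ℝ | (w.1^2 + w.2^2)/2 ≤ F A} ∧
      -- `Ψ` is area- and orientation-preserving (i.e. symplectic): Jacobian `= 1`
      (∀ z ∈ K, LinearMap.det ((fderiv ℝ Ψ z) : (ℝ × ℝ) →ₗ[ℝ] (ℝ × ℝ)) = 1) ∧
      (∀ z ∈ K, F (p z) = ((Ψ z).1^2 + (Ψ z).2^2)/2) ∧
      deriv F (p z₀) =
        1 / Real.sqrt (iteratedFDeriv ℝ 2 p z₀ ![(1,0),(1,0)] *
            iteratedFDeriv ℝ 2 p z₀ ![(0,1),(0,1)]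
          - (iteratedFDeriv ℝ 2 p z₀ ![(1,0),(0,1)])^2) := by
  have hKΩ : K ⊆ Ω := by rw [hKdef]; exact fun z hz => hz.1
  obtain ⟨P, hP, hPp, hPK, C, hC, hPC⟩ := globalize Ω hΩ p A hp K hKdef hKc
  have hPe : ∀ z ∈ K, P z = p z := fun z hz => (hPp z hz).eq_of_nhds
  have hPd : ∀ z ∈ K, fderiv ℝ P z = fderiv ℝ p z := fun z hz => (hPp z hz).fderiv_eq
  have hP2 : iteratedFDeriv ℝ 2 P z₀ = iteratedFDeriv ℝ 2 p z₀ :=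
    (Filter.EventuallyEq.iteratedFDeriv ℝ (hPp z₀ hz₀) 2).eq_of_nhds
  rw [← hP2]
  rw [← hP2] at hHess
  rw [← hPe z₀ hz₀] at hz₀A ⊢
  rw [← hPd z₀ hz₀] at hcrit
  have huniq' : ∀ z, P z ≤ A → fderiv ℝ P z = 0 → z = z₀ := fun z hz hd =>
    huniq z ((hPK z).1 hz) (by rw [← hPd z ((hPK z).1 hz)]; exact hd)
  obtain ⟨e, he0, hez, hes, het, heP, hdpos, hdet⟩ := morse_local P hP z₀ hcrit hHess
  rw [← hdet]
  have hmin := strict_min P hP A C hC hPC z₀ hz₀A huniq'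
  obtain ⟨η, hη, hη1, hηu⟩ := choose_eta P hP A C hC hPC z₀ hz₀A huniq'
  have h0t : (0 : ℝ × ℝ) ∈ e.target := hez ▸ e.map_source he0
  obtain ⟨δ, hδ, hδA, hδS, hδT⟩ := choose_delta P hP A C hC hPC z₀ hz₀A hmin e.source e.target
    (e.open_source.mem_nhds he0) (e.open_target.mem_nhds h0t)
  obtain ⟨φ, φ', σ, hφ, hφ', hσ, i1, i2, hPφ, hφc, hσc, hσm, hσd, hσA⟩ :=
    squeeze P hP A C hC hPC z₀ η hη hη1 hηu (P z₀ + δ / 2) (by linarith) (by linarith)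
      (P z₀ + δ) (by linarith)
  have hσ0 : σ (P z₀) = P z₀ := hσc _ (by linarith)
  have hφ0 : φ z₀ = z₀ := hφc _ (by linarith)
  have hφ'0 : φ' z₀ = z₀ := by conv_lhs => rw [← hφ0, i1]
  let R : ℝ := σ A - P z₀
  have hR0 : 0 ≤ R := by
    have := hσm hz₀A
    rw [hσ0] at this
    simp only [R]; linarith
  have hRδ : R < δ := by simp only [R]; linarith
  let D : Set (ℝ × ℝ) := {w | nrg w ≤ R}
  have hDt : D ⊆ e.target := fun w hw => hδT w (le_trans hw hRδ.le)
  -- the maps `Θ = e ∘ φ` and its inverse `H`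
  let Θ : ℝ × ℝ → ℝ × ℝ := fun z => e (φ z)
  let H : ℝ × ℝ → ℝ × ℝ := fun w => φ' (e.symm w)
  let U : Set (ℝ × ℝ) := Ω ∩ φ ⁻¹' e.source
  have hS : IsOpen (φ ⁻¹' e.source) := e.open_source.preimage hφ.continuous
  have hU : IsOpen U := hΩ.inter hS
  have hΘ : ContDiffOn ℝ (⊤ : ℕ∞) Θ (φ ⁻¹' e.source) := hes.comp hφ.contDiffOn (fun z hz => hz)
  have hH : ContDiffOn ℝ (⊤ : ℕ∞) H e.target := hφ'.comp_contDiffOn het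
  have hKσ : ∀ z, z ∈ K ↔ P (φ z) ≤ σ A := by
    intro z
    rw [← hPK, hPφ, hσm.le_iff_le]
  have hKS : ∀ z ∈ K, φ z ∈ e.source := fun z hz =>
    hδS _ (((hKσ z).1 hz).trans hσA.le)
  have hΘn : ∀ z ∈ K, nrg (Θ z) = σ (P z) - P z₀ := by
    intro z hz
    have := heP _ (hKS z hz)
    rw [hPφ] at this
    simp only [Θ]; linarith
  have hHΘ : ∀ z ∈ K, H (Θ z) = z := by
    intro z hz
    simp only [H, Θ]
    rw [e.left_inv (hKS z hz), i1]
  have hφH : ∀ w, φ (H w) = e.symm w := fun w => i2 _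
  have hΘH : ∀ w ∈ e.target, Θ (H w) = w := by
    intro w hw
    simp only [Θ]
    rw [hφH, e.right_inv hw]
  have hHS : ∀ w ∈ e.target, H w ∈ φ ⁻¹' e.source := by
    intro w hw
    change φ (H w) ∈ e.source
    rw [hφH]; exact e.map_target hw
  have hΘK : BijOn Θ K D := by
    refine ⟨?_, ?_, ?_⟩
    · intro z hz
      change nrg (Θ z) ≤ R
      rw [hΘn z hz]
      have := (hKσ z).1 hz
      rw [hPφ] at this
      simp only [R]; linarith
    · intro z hz z' hz' h
      rw [← hHΘ z hz, h, hHΘ z' hz']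
    · intro w hw
      have hwt := hDt hw
      refine ⟨H w, ?_, hΘH w hwt⟩
      rw [hKσ, hφH]
      have h1 := heP _ (e.map_target hwt)
      rw [e.right_inv hwt] at h1
      have h2 : nrg w ≤ σ A - P z₀ := hw
      linarith
  -- Jacobian of `H`
  let J : ℝ × ℝ → ℝ := fun w => LinearMap.det (fderiv ℝ H w : (ℝ × ℝ) →ₗ[ℝ] (ℝ × ℝ))
  have hJ : ContDiffOn ℝ (⊤ : ℕ∞) J e.target := det_contDiffOn H _ e.open_target hH
  have hHd : ∀ w ∈ e.target, DifferentiableAt ℝ H w := fun w hw =>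
    (hH.contDiffAt (e.open_target.mem_nhds hw)).differentiableAt (by simp)
  have hΘd : ∀ z ∈ φ ⁻¹' e.source, DifferentiableAt ℝ Θ z := fun z hz =>
    (hΘ.contDiffAt (hS.mem_nhds hz)).differentiableAt (by simp)
  have hJΘ : ∀ w ∈ e.target,
      LinearMap.det (fderiv ℝ Θ (H w) : (ℝ × ℝ) →ₗ[ℝ] (ℝ × ℝ)) * J w = 1 := by
    intro w hw
    have h1 := det_chain (hΘd _ (hHS w hw)) (hHd w hw)
    have h2 : (fun w => Θ (H w)) =ᶠ[nhds w] id := by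
      filter_upwards [e.open_target.mem_nhds hw] with y hy
      exact hΘH y hy
    rw [h2.fderiv_eq, fderiv_id] at h1
    rw [← h1]
    exact LinearMap.det_id
  have hJ0 : J 0 = 1 / LinearMap.det (fderiv ℝ e z₀ : (ℝ × ℝ) →ₗ[ℝ] (ℝ × ℝ)) := by
    have h1 := hJΘ 0 h0t
    have h2 : H 0 = z₀ := by
      simp only [H]
      rw [← hez, e.left_inv he0, hφ'0]
    have h3 : Θ =ᶠ[nhds z₀] e := by
      have : ∀ᶠ z in nhds z₀, P z < P z₀ + δ / 2 :=
        hP.continuous.continuousAt.eventually (eventually_lt_nhds (by linarith))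
      filter_upwards [this] with z hz
      simp only [Θ]
      rw [hφc z hz.le]
    rw [h2, h3.fderiv_eq] at h1
    rw [eq_div_iff hdpos.ne', mul_comm]
    exact h1
  have hJpos : ∀ w ∈ D, 0 < J w := by
    intro w hw
    by_contra hneg
    have hsc : ∀ t ∈ Icc (0:ℝ) 1, t • w ∈ D := by
      intro t ht
      have h1 : nrg (t • w) = t ^ 2 * nrg w := by
        simp only [nrg, Prod.smul_fst, Prod.smul_snd, smul_eq_mul]; ring
      change nrg (t • w) ≤ R
      rw [h1]
      have h2 : t ^ 2 ≤ 1 := pow_le_one₀ ht.1 ht.2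
      exact (mul_le_of_le_one_left (nrg_nonneg w) h2).trans hw
    have hcont : ContinuousOn (fun t : ℝ => J (t • w)) (Icc 0 1) :=
      hJ.continuousOn.comp (by fun_prop) (fun t ht => hDt (hsc t ht))
    have h0 : 0 ∈ Icc (J ((1:ℝ) • w)) (J ((0:ℝ) • w)) := by
      rw [one_smul, zero_smul, hJ0]
      exact ⟨not_lt.1 hneg, by positivity⟩
    obtain ⟨t, ht, hJt⟩ := intermediate_value_Icc' zero_le_one hcont h0
    have := hJΘ _ (hDt (hsc t ht))
    beta_reduce at hJt
    rw [hJt, mul_zero] at this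
    exact zero_ne_one this
  let Ω' : Set (ℝ × ℝ) := e.target ∩ J ⁻¹' Ioi 0
  have hΩ' : IsOpen Ω' := hJ.continuousOn.isOpen_inter_preimage e.open_target isOpen_Ioi
  obtain ⟨G, hG, hGJ, ⟨C', -, hC', hGC'⟩, hGc⟩ := extend_cutoff Ω' hΩ' J
    (hJ.mono inter_subset_left) D (isCompact_disc R) (fun w hw => ⟨hDt hw, hJpos w hw⟩) 1
  have hGe : ∀ w ∈ D, G w = J w := fun w hw => (hGJ w hw).eq_of_nhds
  have hGpos : ∀ w, 0 < G w := by
    intro w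
    by_cases hw : w ∈ C'
    · obtain ⟨c, hc, hGw⟩ := hGc w
      have hJw : 0 < J w := (hC' hw).2
      rw [hGw]
      rcases hc.1.eq_or_lt with h | h
      · rw [← h]; norm_num
      · have := mul_pos h hJw
        linarith [hc.2]
    · rw [hGC' w hw]; exact one_pos
  obtain ⟨Ft, Φ, hFt, hΦ, hFt0, hFtp, hFtd, hΦdet, hΦn, hΦb⟩ := correction G hG hGpos
  have h0D : (0 : ℝ × ℝ) ∈ D := by
    change nrg 0 ≤ R
    simpa [nrg] using hR0
  have hFd : ∀ E, HasDerivAt (fun E => Ft (σ E - P z₀)) (deriv Ft (σ E - P z₀) * deriv σ E) E := by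
    intro E
    have h1 := (contDiff_differentiableAt hFt (σ E - P z₀)).hasDerivAt
    have h2 := (contDiff_differentiableAt hσ E).hasDerivAt.sub_const (P z₀)
    exact h1.comp E h2
  refine ⟨fun E => Ft (σ E - P z₀), fun z => Φ (Θ z), U, hFt.comp (hσ.sub contDiff_const), ?_, ?_,
    hU, fun z hz => ⟨hKΩ hz, hKS z hz⟩, inter_subset_left,
    hΦ.comp_contDiffOn (hΘ.mono inter_subset_right), ?_, ?_, ?_, ?_⟩
  · intro t ht
    rw [(hFd t).deriv]
    refine mul_pos (hFtp _ ?_) (hσd t)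
    have := hσm.monotone ht.1
    rw [hσ0] at this
    linarith
  · beta_reduce
    rw [hσ0, sub_self, hFt0]
  · exact (hΦb R hR0).comp hΘK
  · intro z hz
    rw [det_chain (contDiff_differentiableAt hΦ _) (hΘd z (hKS z hz)), hΦdet,
      hGe _ (hΘK.mapsTo hz)]
    have := hJΘ _ (hDt (hΘK.mapsTo hz))
    rw [hHΘ z hz, mul_comm] at this
    exact this
  · intro z hz
    have := hΦn (Θ z)
    rw [hΘn z hz, hPe z hz] at this
    exact this.symm
  · rw [(hFd _).deriv, hσ0, sub_self, hFtd, hGe _ h0D, hJ0]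
    have h1 : σ =ᶠ[nhds (P z₀)] id := by
      filter_upwards [eventually_lt_nhds (show P z₀ < P z₀ + δ / 2 by linarith)] with s hs
      exact hσc s hs.le
    rw [h1.deriv_eq, deriv_id, mul_one]
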